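/- arXiv:0802.2996 — 3 statements merged into one kernel-verified Lean document; each statement's English description precedes it below -/
import Mathlib

section
/- The quantum logarithm φ^h(z) = −(πh/2) ∫_Ω e^{−itz}/(sinh(πt) sinh(πht)) dt satisfies the functional equation φ^h(z) − φ^h(−z) = z for all real z and all real h > 0 with 1/h irrational (the contour Ω going along the real axis from −∞ to ∞ bypassing the origin from above). -/
namespace Stmt4

open Real Complex

/-- Integrand of the quantum logarithm, evaluated on the contour `Ω` realized as the
horizontal line `ℝ + iδ` (the contour along the real axis bypassing the origin from above;
for `0 < δ < min(1, 1/h)` no pole of the integrand lies between the two contours). -/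
noncomputable def qlogIntegrand (h δ z t : ℝ) : ℂ :=
  Complex.exp (-Complex.I * (t + Complex.I * δ) * z) /
    (Complex.sinh (Real.pi * (t + Complex.I * δ)) *
      Complex.sinh (Real.pi * h * (t + Complex.I * δ)))

/-- The quantum logarithm `φ^h(z) = −(πh/2) ∫_Ω e^{−itz}/(sinh(πt) sinh(πht)) dt`. -/
noncomputable def qlog (h δ z : ℝ) : ℂ :=
  -(Real.pi * h / 2) * ∫ t : ℝ, qlogIntegrand h δ z t

lemma normSq_sinh' (x y : ℝ) :
    Complex.normSq (Complex.sinh (x + y * Complex.I)) = Real.sinh x ^ 2 + Real.sin y ^ 2 := by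
  rw [Complex.sinh_add, Complex.sinh_mul_I, Complex.cosh_mul_I, ← Complex.ofReal_sinh,
    ← Complex.ofReal_cosh, ← Complex.ofReal_sin, ← Complex.ofReal_cos, ← mul_assoc,
    ← Complex.ofReal_mul, ← Complex.ofReal_mul, Complex.normSq_add_mul_I]
  have h1 := Real.cosh_sq x
  have h2 := Real.sin_sq_add_cos_sq y
  have h3 : Real.cos y ^ 2 = 1 - Real.sin y ^ 2 := by linarith
  rw [mul_pow, mul_pow, h1, h3]
  ring

lemma sinh_ge (a : ℝ) (x y : ℝ) :
    (a * x) ^ 2 + Real.sin (a * y) ^ 2 ≤ ‖Complex.sinh (a * (x + y * Complex.I))‖ ^ 2 := by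
  have : (a : ℂ) * (x + y * Complex.I) = ((a * x : ℝ) : ℂ) + ((a * y : ℝ) : ℂ) * Complex.I := by
    push_cast; ring
  rw [this, ← Complex.normSq_eq_norm_sq, normSq_sinh']
  have : (a * x) ^ 2 ≤ Real.sinh (a * x) ^ 2 := by
    rw [sq_le_sq]
    rw [Real.abs_sinh]
    exact Real.self_le_sinh_iff.2 (abs_nonneg _)
  linarith

lemma sinh_ne (a : ℝ) (ha : 0 < a) (w : ℂ) (hw : w ≠ 0) (him : a * |w.im| < π) :
    Complex.sinh (a * w) ≠ 0 := by
  intro h0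
  have := sinh_ge a w.re w.im
  rw [Complex.re_add_im, h0] at this
  simp only [norm_zero] at this
  have h1 : a * w.re = 0 := by nlinarith [sq_nonneg (a * w.re), sq_nonneg (Real.sin (a * w.im))]
  have h2 : Real.sin (a * w.im) = 0 := by
    nlinarith [sq_nonneg (a * w.re), sq_nonneg (Real.sin (a * w.im))]
  have h3 : |a * w.im| < π := by rwa [abs_mul, abs_of_pos ha]
  rw [abs_lt] at h3
  have h4 := (Real.sin_eq_zero_iff_of_lt_of_lt h3.1 h3.2).1 h2
  apply hw
  apply Complex.ext
  · simpa [ha.ne'] using h1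
  · simpa [ha.ne'] using h4

lemma sinh_ge_sqrt (a δ : ℝ) (ha : 0 < a) (hδ0 : 0 < δ) (hδ : a * δ < π) :
    ∃ m > 0, ∀ t : ℝ, m * √(1 + t ^ 2) ≤ ‖Complex.sinh (a * (t + δ * Complex.I))‖ := by
  have hs : 0 < Real.sin (a * δ) := Real.sin_pos_of_pos_of_lt_pi (by positivity) hδ
  refine ⟨min a (Real.sin (a * δ)), lt_min ha hs, fun t => ?_⟩
  set m := min a (Real.sin (a * δ)) with hm
  have hm0 : 0 < m := lt_min ha hs
  refine (pow_le_pow_iff_left₀ (by positivity) (norm_nonneg _) two_ne_zero).1 ?_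
  refine le_trans ?_ (sinh_ge a t δ)
  rw [mul_pow, Real.sq_sqrt (by positivity), mul_pow]
  have h1 : m ^ 2 ≤ a ^ 2 := pow_le_pow_left₀ hm0.le (min_le_left _ _) 2
  have h2 : m ^ 2 ≤ Real.sin (a * δ) ^ 2 := pow_le_pow_left₀ hm0.le (min_le_right _ _) 2
  nlinarith [mul_le_mul_of_nonneg_right h1 (sq_nonneg t)]

lemma integrable_aux (h δ : ℝ) (hh : 0 < h)
    (hδ0 : 0 < δ) (hδ : δ < min 1 (1 / h)) (z : ℝ) :
    MeasureTheory.Integrable (qlogIntegrand h δ z) := by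
  have hd1 : δ < 1 := hδ.trans_le (min_le_left _ _)
  have hd2 : h * δ < 1 := by
    have := hδ.trans_le (min_le_right _ _)
    rw [lt_div_iff₀ hh] at this; linarith
  obtain ⟨m, hm, hM⟩ := sinh_ge_sqrt π δ Real.pi_pos hδ0 (by nlinarith [Real.pi_pos])
  obtain ⟨n, hn, hN⟩ := sinh_ge_sqrt (π * h) δ (by positivity) hδ0 (by nlinarith [Real.pi_pos])
  have hM0 : ∀ t : ℝ, 0 < ‖Complex.sinh (π * (t + δ * Complex.I))‖ := fun t =>
    lt_of_lt_of_le (by positivity) (hM t)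
  have hN0 : ∀ t : ℝ, 0 < ‖Complex.sinh ((π * h : ℝ) * (t + δ * Complex.I))‖ := fun t =>
    lt_of_lt_of_le (by positivity) (hN t)
  have key : ∀ t : ℝ, qlogIntegrand h δ z t = Complex.exp (-Complex.I * (t + Complex.I * δ) * z) /
    (Complex.sinh (Real.pi * (t + δ * Complex.I)) *
      Complex.sinh ((Real.pi * h : ℝ) * (t + δ * Complex.I))) := by
    intro t
    simp only [qlogIntegrand]
    push_cast
    rw [mul_comm Complex.I (δ : ℂ)]
  refine MeasureTheory.Integrable.mono'
    (g := fun t => Real.exp (δ * z) / (m * n) * (1 + t ^ 2)⁻¹)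
    (integrable_inv_one_add_sq.const_mul _) ?_ ?_
  · apply Continuous.aestronglyMeasurable
    rw [show qlogIntegrand h δ z = _ from funext key]
    apply Continuous.div (by fun_prop) (by fun_prop)
    intro t
    exact mul_ne_zero (norm_pos_iff.1 (hM0 t)) (norm_pos_iff.1 (hN0 t))
  · refine Filter.Eventually.of_forall fun t => ?_
    rw [key, norm_div, norm_mul, Complex.norm_exp]
    have : (-Complex.I * (t + Complex.I * δ) * z).re = δ * z := by simp
    rw [this, div_mul_eq_mul_div, ← div_eq_mul_inv, div_div]
    apply div_le_div_of_nonneg_left (by positivity) (by positivity)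
    calc (1 + t ^ 2) * (m * n) = (m * √(1 + t ^ 2)) * (n * √(1 + t ^ 2)) := by
          have : √(1 + t ^ 2) * √(1 + t ^ 2) = 1 + t ^ 2 := Real.mul_self_sqrt (by positivity)
          linear_combination (-(m * n)) * this
      _ ≤ _ := mul_le_mul (hM t) (hN t) (by positivity) (norm_nonneg _)

/-- Antisymmetrized integrand. -/
noncomputable def GG (a b z : ℝ) (w : ℂ) : ℂ :=
  -2 * Complex.I * Complex.sin (w * z) / (Complex.sinh (a * w) * Complex.sinh (b * w))

noncomputable def NN (a b z : ℝ) (w : ℂ) : ℂ :=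
  -2 * Complex.I * dslope (fun w : ℂ => Complex.sin (w * z)) 0 w /
    (dslope (fun w : ℂ => Complex.sinh (a * w)) 0 w *
     dslope (fun w : ℂ => Complex.sinh (b * w)) 0 w)

lemma dslope_sinh_zero (a : ℝ) : dslope (fun w : ℂ => Complex.sinh (a * w)) 0 0 = a := by
  rw [dslope_same]
  have : HasDerivAt (fun w : ℂ => Complex.sinh (a * w)) (Complex.cosh (a * 0) * (a * 1)) 0 :=
    ((hasDerivAt_id (0 : ℂ)).const_mul (a : ℂ)).csinh
  rw [this.deriv]; simp

lemma dslope_sin_zero (z : ℝ) : dslope (fun w : ℂ => Complex.sin (w * z)) 0 0 = z := by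
  rw [dslope_same]
  have : HasDerivAt (fun w : ℂ => Complex.sin (w * z)) (Complex.cos (0 * z) * (1 * z)) 0 :=
    ((hasDerivAt_id (0 : ℂ)).mul_const (z : ℂ)).csin
  rw [this.deriv]; simp

lemma NN_zero (a b z : ℝ) : NN a b z 0 = -2 * Complex.I * z / (a * b) := by
  simp only [NN, dslope_sinh_zero, dslope_sin_zero]

lemma NN_ne (a b z : ℝ) (w : ℂ) (hw : w ≠ 0) : NN a b z w = w * GG a b z w := by
  simp only [NN, GG, dslope_of_ne _ hw, slope_def_field]
  simp only [mul_zero, zero_mul, Complex.sin_zero, Complex.sinh_zero, sub_zero]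
  by_cases h1 : Complex.sinh (a * w) = 0
  · simp [h1]
  by_cases h2 : Complex.sinh (b * w) = 0
  · simp [h2]
  field_simp

noncomputable def KK (a b z : ℝ) : ℂ → ℂ := dslope (NN a b z) 0

lemma KK_ne (a b z : ℝ) (w : ℂ) (hw : w ≠ 0) :
    KK a b z w = GG a b z w - (-2 * Complex.I * z / (a * b)) / w := by
  rw [KK, dslope_of_ne _ hw, slope_def_field, NN_ne _ _ _ _ hw, NN_zero, sub_zero, sub_div,
    mul_div_cancel_left₀ _ hw]

lemma KK_neg (a b z : ℝ) (w : ℂ) (hw : w ≠ 0) : KK a b z (-w) = - KK a b z w := by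
  rw [KK_ne _ _ _ _ hw, KK_ne _ _ _ _ (neg_ne_zero.2 hw)]
  simp only [GG, neg_mul, mul_neg, Complex.sin_neg, Complex.sinh_neg, div_neg, neg_neg]
  ring

lemma KK_diff (a b z M : ℝ) (ha : 0 < a) (hb : 0 < b) (hM : 0 < M) (haM : a * M ≤ π)
    (hbM : b * M ≤ π) : DifferentiableOn ℂ (KK a b z) {w : ℂ | |w.im| < M} := by
  have hopen : IsOpen {w : ℂ | |w.im| < M} :=
    isOpen_lt (by fun_prop) continuous_const
  have hnh : {w : ℂ | |w.im| < M} ∈ nhds (0 : ℂ) := hopen.mem_nhds (by simpa using hM)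
  have hs : ∀ f : ℂ → ℂ, Differentiable ℂ f → DifferentiableOn ℂ (dslope f 0) {w : ℂ | |w.im| < M} :=
    fun f hf => (Complex.differentiableOn_dslope hnh).2 hf.differentiableOn
  have hne : ∀ a : ℝ, 0 < a → a * M ≤ π → ∀ w : ℂ, |w.im| < M →
      dslope (fun w : ℂ => Complex.sinh (a * w)) 0 w ≠ 0 := by
    intro a ha haM w hw
    by_cases h0 : w = 0
    · rw [h0, dslope_sinh_zero]; exact_mod_cast ha.ne'
    · rw [dslope_of_ne _ h0, slope_def_field]
      simp only [mul_zero, Complex.sinh_zero, sub_zero]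
      exact div_ne_zero (sinh_ne a ha w h0 (lt_of_lt_of_le (by gcongr) haM)) h0
  rw [KK, Complex.differentiableOn_dslope hnh]
  apply DifferentiableOn.div
  · exact (hs _ (by fun_prop)).const_mul _
  · exact (hs _ (by fun_prop)).mul (hs _ (by fun_prop))
  · intro w hw
    exact mul_ne_zero (hne a ha haM w hw) (hne b hb hbM w hw)

lemma norm_sin_le (w : ℂ) : ‖Complex.sin w‖ ≤ Real.exp |w.im| := by
  have h2 : Complex.sin w =
      (Complex.exp (-w * Complex.I) - Complex.exp (w * Complex.I)) * Complex.I / 2 := rfl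
  rw [h2, norm_div, norm_mul, Complex.norm_I, mul_one, Complex.norm_ofNat]
  have h3 : ‖Complex.exp (-w * Complex.I)‖ ≤ Real.exp |w.im| := by
    rw [Complex.norm_exp]; apply Real.exp_le_exp.2; simpa using le_abs_self _
  have h4 : ‖Complex.exp (w * Complex.I)‖ ≤ Real.exp |w.im| := by
    rw [Complex.norm_exp]; apply Real.exp_le_exp.2; simpa using neg_le_abs _
  have := norm_sub_le (Complex.exp (-w * Complex.I)) (Complex.exp (w * Complex.I))
  linarith

lemma KK_bound (a b z δ : ℝ) (ha : 0 < a) (hb : 0 < b) :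
    ∃ C, ∀ R : ℝ, 1 ≤ R → ∀ y : ℝ, |y| ≤ δ → ‖KK a b z (R + y * Complex.I)‖ ≤ C / R := by
  refine ⟨2 * Real.exp (δ * |z|) / (a * b) + ‖(-2 * Complex.I * z / (a * b) : ℂ)‖,
    fun R hR y hy => ?_⟩
  have hR0 : 0 < R := by linarith
  have hre : R ≤ ‖(R + y * Complex.I : ℂ)‖ := by
    have := Complex.re_le_norm (R + y * Complex.I : ℂ)
    simpa using this
  have hw : (R + y * Complex.I : ℂ) ≠ 0 := norm_pos_iff.1 (by linarith)
  have hsh : ∀ a : ℝ, 0 < a → a * R ≤ ‖Complex.sinh (a * (R + y * Complex.I))‖ := by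
    intro a ha
    refine (pow_le_pow_iff_left₀ (by positivity) (norm_nonneg _) two_ne_zero).1 ?_
    have := sinh_ge a R y
    nlinarith [sq_nonneg (Real.sin (a * y))]
  rw [KK_ne _ _ _ _ hw, add_div]
  refine (norm_sub_le _ _).trans (add_le_add ?_ ?_)
  · rw [GG, norm_div, norm_mul, norm_mul, norm_mul, div_div]
    apply div_le_div₀ (by positivity)
    · have := norm_sin_le ((R + y * Complex.I) * z)
      have h5 : |((R + y * Complex.I) * z : ℂ).im| ≤ δ * |z| := by
        simp [abs_mul]; gcongr
      have := this.trans (Real.exp_le_exp.2 h5)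
      simpa using this
    · positivity
    · calc a * b * R ≤ (a * R) * (b * R) := by
            have : 0 ≤ a * b * R * (R - 1) := by
              have : 0 ≤ R - 1 := by linarith
              positivity
            nlinarith
        _ ≤ _ := mul_le_mul (hsh a ha) (hsh b hb) (by positivity) (norm_nonneg _)
  · rw [norm_div]
    gcongr

lemma T_eq (a b z δ M : ℝ) (ha : 0 < a) (hb : 0 < b) (hδ0 : 0 < δ) (hδM : δ < M)
    (haM : a * M ≤ π) (hbM : b * M ≤ π) (R : ℝ) (hR : 1 ≤ R) :
    ∫ t in (-R)..R, KK a b z (t + δ * Complex.I) =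
      Complex.I * ∫ y in (-δ)..δ, KK a b z (R + y * Complex.I) := by
  have hrect := Complex.integral_boundary_rect_eq_zero_of_differentiableOn (KK a b z)
    (⟨-R, -δ⟩ : ℂ) ⟨R, δ⟩ (by
      apply (KK_diff a b z M ha hb (by linarith) haM hbM).mono
      intro w hw
      rw [Complex.mem_reProdIm] at hw
      have := hw.2
      simp only at this
      rw [Set.uIcc_of_le (by linarith)] at this
      exact (abs_le.2 this).trans_lt hδM)
  simp only [smul_eq_mul] at hrect
  have e1 : ∫ x in (-R)..R, KK a b z (x + ((-δ : ℝ) : ℂ) * Complex.I) =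
      - ∫ t in (-R)..R, KK a b z (t + δ * Complex.I) := by
    have := intervalIntegral.integral_comp_neg (a := -R) (b := R)
      (fun x : ℝ => KK a b z (x + ((-δ : ℝ) : ℂ) * Complex.I))
    rw [neg_neg] at this
    rw [← this, ← intervalIntegral.integral_neg]
    congr 1; ext t
    rw [← KK_neg]
    · congr 1; push_cast; ring
    · intro h0
      have := congrArg Complex.im h0
      simp at this; linarith
  have e2 : ∫ y in (-δ)..δ, KK a b z (((-R : ℝ) : ℂ) + y * Complex.I) =
      - ∫ y in (-δ)..δ, KK a b z (R + y * Complex.I) := by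
    have := intervalIntegral.integral_comp_neg (a := -δ) (b := δ)
      (fun y : ℝ => KK a b z (((-R : ℝ) : ℂ) + y * Complex.I))
    rw [neg_neg] at this
    rw [← this, ← intervalIntegral.integral_neg]
    congr 1; ext t
    rw [← KK_neg]
    · congr 1; push_cast; ring
    · intro h0
      have := congrArg Complex.re h0
      simp at this; linarith
  rw [e1, e2] at hrect
  linear_combination (-1 / 2) * hrect

lemma T_tendsto (a b z δ M : ℝ) (ha : 0 < a) (hb : 0 < b) (hδ0 : 0 < δ) (hδM : δ < M)
    (haM : a * M ≤ π) (hbM : b * M ≤ π) :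
    Filter.Tendsto (fun R : ℝ => ∫ t in (-R)..R, KK a b z (t + δ * Complex.I))
      Filter.atTop (nhds 0) := by
  obtain ⟨C, hC⟩ := KK_bound a b z δ ha hb
  apply squeeze_zero_norm' (a := fun R : ℝ => C / R * |δ - (-δ)|)
  · filter_upwards [Filter.eventually_ge_atTop 1] with R hR
    rw [T_eq a b z δ M ha hb hδ0 hδM haM hbM R hR, norm_mul, Complex.norm_I, one_mul]
    apply intervalIntegral.norm_integral_le_of_norm_le_const
    intro y hy
    rw [Set.uIoc_of_le (by linarith)] at hy
    exact hC R hR y (abs_le.2 ⟨hy.1.le, hy.2⟩)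
  · have : Filter.Tendsto (fun R : ℝ => C / R) Filter.atTop (nhds 0) :=
      tendsto_const_nhds.div_atTop Filter.tendsto_id
    simpa using this.mul_const (|δ - (-δ)|)

lemma inv_tendsto (δ : ℝ) (hδ0 : 0 < δ) :
    Filter.Tendsto (fun R : ℝ => ∫ t in (-R)..R, (t + δ * Complex.I : ℂ)⁻¹)
      Filter.atTop (nhds (-(π * Complex.I))) := by
  have hlim : ∀ s : ℝ, Filter.Tendsto (fun R : ℝ => Complex.log (1 + (s / R : ℝ) * Complex.I))
      Filter.atTop (nhds 0) := by
    intro s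
    have h1 : Filter.Tendsto (fun R : ℝ => s / R) Filter.atTop (nhds 0) :=
      tendsto_const_nhds.div_atTop Filter.tendsto_id
    have h2 : ContinuousAt (fun x : ℝ => Complex.log (1 + (x : ℂ) * Complex.I)) 0 := by
      apply ContinuousAt.clog (by fun_prop)
      simp
    have := h2.tendsto.comp h1
    simpa [Function.comp_def] using this
  have := ((hlim δ).sub (hlim (-δ))).sub_const ((π : ℂ) * Complex.I)
  rw [sub_zero, zero_sub] at this
  refine this.congr' ?_
  filter_upwards [Filter.eventually_gt_atTop 0] with R hR
  have hRc : (R : ℂ) ≠ 0 := by exact_mod_cast hR.ne'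
  have hslit : ∀ t : ℝ, (t + δ * Complex.I : ℂ) ∈ Complex.slitPlane := by
    intro t; right; simp [hδ0.ne']
  have hd : ∀ t : ℝ, HasDerivAt (fun t : ℝ => Complex.log (t + δ * Complex.I))
      ((t + δ * Complex.I : ℂ)⁻¹) t := by
    intro t
    have := ((Complex.ofRealCLM.hasDerivAt (x := t)).add_const (δ * Complex.I)).clog_real (hslit t)
    simpa using this
  rw [intervalIntegral.integral_eq_sub_of_hasDerivAt (fun t _ => hd t)]
  · have f1 : Complex.log ((R : ℂ) + δ * Complex.I) =
        Real.log R + Complex.log (1 + (δ / R : ℝ) * Complex.I) := by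
      rw [← Complex.log_ofReal_mul hR]
      · congr 1; push_cast; field_simp [hRc]
      · intro h0; have := congrArg Complex.re h0; simp at this
    have f3 : Complex.log (-(1 + (-δ / R : ℝ) * Complex.I)) =
        Complex.log (1 + (-δ / R : ℝ) * Complex.I) + π * Complex.I := by
      have him : (1 + (-δ / R : ℝ) * Complex.I : ℂ).im < 0 := by
        simp
        first | positivity | (rw [neg_div]; simp; positivity)
      rw [Complex.log, Complex.log, norm_neg, Complex.arg_neg_eq_arg_add_pi_of_im_neg him]
      push_cast; ring
    have f2 : Complex.log (((-R : ℝ) : ℂ) + δ * Complex.I) =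
        Real.log R + (Complex.log (1 + (-δ / R : ℝ) * Complex.I) + π * Complex.I) := by
      rw [← f3, ← Complex.log_ofReal_mul hR]
      · congr 1; push_cast; field_simp [hRc]; ring
      · intro h0; have := congrArg Complex.re h0; simp at this
    rw [f1, f2]; ring
  · apply Continuous.intervalIntegrable
    apply Continuous.inv₀ (by fun_prop)
    intro t
    exact Complex.slitPlane_ne_zero (hslit t)

lemma integrand_sub (h δ z t : ℝ) : qlogIntegrand h δ z t - qlogIntegrand h δ (-z) t =
    GG π (π * h) z (t + δ * Complex.I) := by
  simp only [qlogIntegrand, GG]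
  rw [← sub_div, mul_comm Complex.I (δ : ℂ)]
  congr 1
  · rw [Complex.sin]
    have e1 : -Complex.I * (t + δ * Complex.I) * z = -((t + δ * Complex.I) * z) * Complex.I := by
      ring
    have e2 : -Complex.I * (t + δ * Complex.I) * (-z : ℝ) = ((t + δ * Complex.I) * z) * Complex.I := by
      push_cast; ring
    rw [e1, e2]
    linear_combination ((Complex.exp (-((t + δ * Complex.I) * z) * Complex.I) -
      Complex.exp (((t + δ * Complex.I) * z) * Complex.I))) * Complex.I_sq
  · push_cast; rfl

/-- The quantum logarithm satisfies `φ^h(z) − φ^h(−z) = z` for all real `z`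
and real `h > 0` with `1/h` irrational. -/
theorem qlog_sub_qlog_neg (h δ : ℝ) (hh : 0 < h) (hirr : Irrational (1 / h))
    (hδ0 : 0 < δ) (hδ : δ < min 1 (1 / h)) (z : ℝ) :
    qlog h δ z - qlog h δ (-z) = (z : ℂ) := by
  have i1 := integrable_aux h δ hh hδ0 hδ z
  have i2 := integrable_aux h δ hh hδ0 hδ (-z)
  have hG : MeasureTheory.Integrable (fun t : ℝ => GG π (π * h) z (t + δ * Complex.I)) := by
    have := i1.sub i2
    refine this.congr (Filter.Eventually.of_forall fun t => ?_)
    exact integrand_sub h δ z t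
  have hlim1 := MeasureTheory.intervalIntegral_tendsto_integral hG
    Filter.tendsto_neg_atTop_atBot Filter.tendsto_id
  have hb : 0 < π * h := by positivity
  have haM : π * min 1 (1 / h) ≤ π := by
    have := min_le_left 1 (1 / h); nlinarith [Real.pi_pos]
  have hbM : π * h * min 1 (1 / h) ≤ π := by
    calc π * h * min 1 (1 / h) ≤ π * h * (1 / h) := by gcongr; exact min_le_right _ _
      _ = π := by field_simp
  have hT := T_tendsto π (π * h) z δ _ Real.pi_pos hb hδ0 hδ haM hbM
  set c : ℂ := -2 * Complex.I * z / ((π : ℝ) * (π * h : ℝ)) with hc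
  have hI := (inv_tendsto δ hδ0).const_mul c
  have hlim2 := hT.add hI
  have hw : ∀ t : ℝ, (t + δ * Complex.I : ℂ) ≠ 0 := by
    intro t h0
    have := congrArg Complex.im h0
    simp at this; linarith
  have hval : ∫ t : ℝ, GG π (π * h) z (t + δ * Complex.I) = 0 + c * (-(π * Complex.I)) := by
    refine tendsto_nhds_unique hlim1 (hlim2.congr fun R => ?_)
    have hii : IntervalIntegrable (fun t : ℝ => (t + δ * Complex.I : ℂ)⁻¹) MeasureTheory.volume
        (-R) R := by
      apply Continuous.intervalIntegrable
      exact Continuous.inv₀ (by fun_prop) hw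
    have hK : (fun t : ℝ => KK π (π * h) z (t + δ * Complex.I)) = fun t : ℝ =>
        GG π (π * h) z (t + δ * Complex.I) - c * (t + δ * Complex.I : ℂ)⁻¹ := by
      ext t
      rw [KK_ne _ _ _ _ (hw t), div_eq_mul_inv]
    rw [hK, intervalIntegral.integral_sub hG.intervalIntegrable (hii.const_mul c),
      intervalIntegral.integral_const_mul]
    simp
  have hsub : (∫ t : ℝ, qlogIntegrand h δ z t) - ∫ t : ℝ, qlogIntegrand h δ (-z) t =
      ∫ t : ℝ, GG π (π * h) z (t + δ * Complex.I) := by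
    rw [← MeasureTheory.integral_sub i1 i2]
    simp only [integrand_sub]
  rw [qlog, qlog, ← mul_sub, hsub, hval, hc]
  have hp : (π : ℂ) ≠ 0 := by exact_mod_cast Real.pi_ne_zero
  have hh' : (h : ℂ) ≠ 0 := by exact_mod_cast hh.ne'
  push_cast
  field_simp
  linear_combination (-2 * (z : ℂ)) * Complex.I_sq

end Stmt4
end

section
/- The quantum logarithm φ^h satisfies the classical limit lim_{h→0} φ^h(z) = log(1 + e^z) for each fixed real z. -/
namespace Stmt5

open Real Complex Filter

/-- Integrand of the quantum logarithm, evaluated on the contour `Ω` realized as the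
horizontal line `ℝ + iδ` (the contour along the real axis bypassing the origin from above). -/
noncomputable def qlogIntegrand (h δ z t : ℝ) : ℂ :=
  Complex.exp (-Complex.I * (t + Complex.I * δ) * z) /
    (Complex.sinh (Real.pi * (t + Complex.I * δ)) *
      Complex.sinh (Real.pi * h * (t + Complex.I * δ)))

/-- The quantum logarithm `φ^h(z) = −(πh/2) ∫_Ω e^{−itz}/(sinh(πt) sinh(πht)) dt`. -/
noncomputable def qlog (h δ z : ℝ) : ℂ :=
  -(Real.pi * h / 2) * ∫ t : ℝ, qlogIntegrand h δ z t


lemma aux_norm_sinh_ge (w : ℂ) : Real.cosh w.re * |Real.sin w.im| ≤ ‖Complex.sinh w‖ := by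
  have h : (Complex.sinh w).im = Real.cosh w.re * Real.sin w.im := by
    conv_lhs => rw [← Complex.re_add_im w, Complex.sinh_add, Complex.sinh_mul_I, Complex.cosh_mul_I]
    simp [← Complex.ofReal_sinh, ← Complex.ofReal_cosh, ← Complex.ofReal_sin, ← Complex.ofReal_cos]
  have := Complex.abs_im_le_norm (Complex.sinh w)
  rwa [h, abs_mul, abs_of_pos (Real.cosh_pos _)] at this

lemma aux_norm_sinh_ge' (w : ℂ) : |Real.sinh w.re| ≤ ‖Complex.sinh w‖ := by
  have h : ‖Complex.sinh w‖ ^ 2 = Real.sinh w.re ^ 2 + Real.sin w.im ^ 2 := by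
    rw [Complex.sq_norm, Complex.normSq_apply]
    conv_lhs => rw [← Complex.re_add_im w, Complex.sinh_add, Complex.sinh_mul_I, Complex.cosh_mul_I]
    simp [← Complex.ofReal_sinh, ← Complex.ofReal_cosh, ← Complex.ofReal_sin, ← Complex.ofReal_cos]
    have h1 := Real.cosh_sq w.re
    have h2 := Real.sin_sq_add_cos_sq w.im
    linear_combination Real.sinh w.re ^ 2 * h2 + Real.sin w.im ^2 * h1
  refine abs_le_of_sq_le_sq ?_ (norm_nonneg _)
  nlinarith [sq_nonneg (Real.sin w.im)]

lemma aux_cosh_ge (t : ℝ) : 1 + t ^ 2 ≤ Real.cosh (π * t) := by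
  have h1 : Real.cosh (π * t) = 1 + 2 * Real.sinh (π * t / 2) ^ 2 := by
    have := Real.cosh_two_mul (π * t / 2)
    rw [Real.cosh_sq] at this
    rw [show π * t = 2 * (π * t / 2) by ring, this]; ring_nf
  have h2 : |t| ≤ |Real.sinh (π * t / 2)| := by
    rw [Real.abs_sinh, abs_div, abs_mul, abs_of_pos pi_pos, abs_two]
    have h3 : |t| ≤ π * |t| / 2 := by nlinarith [abs_nonneg t, pi_gt_three]
    exact h3.trans (Real.self_le_sinh_iff.2 ((abs_nonneg t).trans h3))
  have := sq_le_sq.2 h2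
  rw [h1]; nlinarith

lemma aux_sech (z : ℝ) :
    ∫ t : ℝ, Complex.exp (-I * t * z) / Complex.cosh (π * t) = 1 / Complex.cosh (z / 2) := by
  set a : ℂ := 1 / 2 - I * z / (2 * π) with ha
  have hre : a.re = 1 / 2 := by
    have : I * z / (2 * π) = ((z / (2 * π) : ℝ) : ℂ) * I := by push_cast; ring
    rw [ha, this]; simp [-ofReal_div]
  have hB := Complex.Gamma_mul_Gamma_eq_betaIntegral (s := a) (t := 1 - a)
    (by rw [hre]; norm_num) (by rw [sub_re, hre]; norm_num)
  rw [Complex.Gamma_mul_Gamma_one_sub, add_sub_cancel, Complex.Gamma_one, one_mul,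
    Complex.betaIntegral, intervalIntegral.integral_of_le zero_le_one,
    MeasureTheory.integral_Ioc_eq_integral_Ioo, ← range_sigmoid, ← Set.image_univ,
    MeasureTheory.integral_image_eq_integral_abs_deriv_smul MeasurableSet.univ
      (fun x _ => (Real.hasDerivAt_sigmoid x).hasDerivWithinAt) Real.sigmoid_injective.injOn,
    MeasureTheory.setIntegral_univ] at hB
  have hpt : ∀ s : ℝ, |Real.sigmoid s * (1 - Real.sigmoid s)| •
      ((Real.sigmoid s : ℂ) ^ (a - 1) * (1 - (Real.sigmoid s : ℂ)) ^ (1 - a - 1)) =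
      (fun t : ℝ => Complex.exp (-I * t * z) / (2 * Complex.cosh (π * t))) ((2 * π)⁻¹ * s) := by
    intro s
    have h0 := Real.sigmoid_pos s
    have h1 := Real.sigmoid_pos (-s)
    rw [Real.sigmoid_neg] at h1
    have hc : 0 < 2 * Real.cosh (s / 2) := by have := Real.cosh_pos (s/2); positivity
    have e0 : Real.sigmoid s = Real.exp (s / 2) / (2 * Real.cosh (s / 2)) := by
      rw [Real.sigmoid_def, Real.cosh_eq, eq_div_iff (by positivity), inv_mul_eq_iff_eq_mul₀ (by positivity)]
      rw [add_mul, ← Real.exp_add]; ring_nf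
    have e1 : 1 - Real.sigmoid s = Real.exp (-(s / 2)) / (2 * Real.cosh (s / 2)) := by
      rw [e0, eq_div_iff hc.ne', sub_mul, div_mul_cancel₀ _ hc.ne', Real.cosh_eq]; ring
    have l0 : Real.log (Real.sigmoid s) = s / 2 - Real.log (2 * Real.cosh (s / 2)) := by
      rw [e0, Real.log_div (Real.exp_ne_zero _) hc.ne', Real.log_exp]
    have l1 : Real.log (1 - Real.sigmoid s) = -(s / 2) - Real.log (2 * Real.cosh (s / 2)) := by
      rw [e1, Real.log_div (Real.exp_ne_zero _) hc.ne', Real.log_exp]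
    rw [abs_of_pos (mul_pos h0 h1)]
    have h0' : (Real.sigmoid s : ℂ) ≠ 0 := by exact_mod_cast h0.ne'
    have h1' : ((1 - Real.sigmoid s : ℝ) : ℂ) ≠ 0 := by exact_mod_cast h1.ne'
    rw [show (1 - (Real.sigmoid s : ℂ)) = ((1 - Real.sigmoid s : ℝ) : ℂ) by push_cast; rfl]
    rw [Complex.real_smul, Complex.ofReal_mul]
    have r0 : (Real.sigmoid s : ℂ) * (Real.sigmoid s : ℂ) ^ (a - 1) = (Real.sigmoid s : ℂ) ^ a := by
      rw [Complex.cpow_sub _ _ h0', Complex.cpow_one]; field_simp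
    have r1 : ((1 - Real.sigmoid s : ℝ) : ℂ) * ((1 - Real.sigmoid s : ℝ) : ℂ) ^ (1 - a - 1) =
        ((1 - Real.sigmoid s : ℝ) : ℂ) ^ (1 - a) := by
      rw [Complex.cpow_sub _ _ h1', Complex.cpow_one]; field_simp
    rw [mul_mul_mul_comm, r0, r1, Complex.cpow_def_of_ne_zero h0', Complex.cpow_def_of_ne_zero h1',
      ← Complex.ofReal_log h0.le, ← Complex.ofReal_log h1.le, l0, l1, ← Complex.exp_add]
    have hL : Complex.exp ((Real.log (2 * Real.cosh (s / 2)) : ℝ) : ℂ) = 2 * Complex.cosh (s / 2) := by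
      rw [← Complex.ofReal_exp, Real.exp_log hc]; push_cast; rfl
    have hpi : (π : ℂ) ≠ 0 := by exact_mod_cast pi_ne_zero
    have harg : (π : ℂ) * ((((2 * π)⁻¹ * s : ℝ)) : ℂ) = s / 2 := by
      push_cast; field_simp
    simp only [harg]
    rw [← hL, ← Complex.exp_sub]
    congr 1
    rw [ha]; push_cast
    field_simp
    ring
  simp_rw [hpt] at hB
  have hsub := MeasureTheory.Measure.integral_comp_mul_left
    (fun t : ℝ => Complex.exp (-I * t * z) / (2 * Complex.cosh (π * t))) ((2 * π)⁻¹)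
  rw [hsub] at hB
  have hpi : (π : ℂ) ≠ 0 := by exact_mod_cast pi_ne_zero
  have hs : Complex.sin (π * a) = Complex.cosh (z / 2) := by
    rw [ha, ← Complex.cos_mul_I, show (π : ℂ) * (1 / 2 - I * z / (2 * π)) = π / 2 - z / 2 * I by
      field_simp, Complex.sin_pi_div_two_sub]
  rw [hs, inv_inv, abs_of_pos (by positivity), Complex.real_smul] at hB
  have h2 : ∀ t : ℝ, Complex.exp (-I * t * z) / (2 * Complex.cosh (π * t)) =
     (1 / 2) * (Complex.exp (-I * t * z) / Complex.cosh (π * t)) := by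
    intro t; rw [mul_comm (2:ℂ), ← div_div]; ring
  simp_rw [h2, MeasureTheory.integral_const_mul] at hB
  push_cast at hB
  have h3 : (π : ℂ) * (∫ t : ℝ, Complex.exp (-I * t * z) / Complex.cosh (π * t)) =
     π * (1 / Complex.cosh (z / 2)) := by
    rw [mul_one_div, hB]; ring
  exact mul_left_cancel₀ hpi h3

lemma aux_norm_exp (δ z t : ℝ) :
    ‖Complex.exp (-I * (t + I * δ) * z)‖ = Real.exp (δ * z) := by
  rw [Complex.norm_exp]; congr 1; simp

lemma aux_sin_pos {δ : ℝ} (h0 : 0 < δ) (h1 : δ < 1) : 0 < Real.sin (π * δ) :=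
  Real.sin_pos_of_pos_of_lt_pi (by positivity) (by nlinarith [pi_pos])

lemma aux_sinh_lower {δ : ℝ} (h0 : 0 < δ) (h1 : δ < 1) (t : ℝ) :
    (1 + t ^ 2) * Real.sin (π * δ) ≤ ‖Complex.sinh (π * (t + I * δ))‖ := by
  have h := aux_norm_sinh_ge (π * (t + I * δ))
  have e1 : ((π : ℂ) * (t + I * δ)).re = π * t := by simp
  have e2 : ((π : ℂ) * (t + I * δ)).im = π * δ := by simp
  have hs := aux_sin_pos h0 h1
  rw [e1, e2, abs_of_pos hs] at h
  exact (mul_le_mul_of_nonneg_right (aux_cosh_ge t) hs.le).trans h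

lemma aux_sinh_ne {δ : ℝ} (h0 : 0 < δ) (h1 : δ < 1) (t : ℝ) :
    Complex.sinh (π * (t + I * δ)) ≠ 0 := by
  have h := aux_sinh_lower h0 h1 t
  have hs := aux_sin_pos h0 h1
  have : 0 < (1 + t ^ 2) * Real.sin (π * δ) := by positivity
  exact norm_pos_iff.1 (this.trans_le h)

lemma aux_bound {δ : ℝ} (h0 : 0 < δ) (h1 : δ < 1) (z t : ℝ) :
    ‖Complex.exp (-I * (t + I * δ) * z) / Complex.sinh (π * (t + I * δ))‖ ≤
      Real.exp (δ * z) / Real.sin (π * δ) * (1 + t ^ 2)⁻¹ := by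
  have hs := aux_sin_pos h0 h1
  rw [norm_div, aux_norm_exp, div_mul_eq_mul_div, ← div_eq_mul_inv, div_div]
  exact div_le_div_of_nonneg_left (Real.exp_pos _).le (by positivity) (aux_sinh_lower h0 h1 t)

lemma aux_cont {δ : ℝ} (h0 : 0 < δ) (h1 : δ < 1) (z : ℝ) :
    Continuous fun t : ℝ => Complex.exp (-I * (t + I * δ) * z) / Complex.sinh (π * (t + I * δ)) := by
  refine Continuous.div (by fun_prop) ?_ (fun t => aux_sinh_ne h0 h1 t)
  exact Complex.continuous_sinh.comp (by fun_prop)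

lemma aux_int {δ : ℝ} (h0 : 0 < δ) (h1 : δ < 1) (z : ℝ) :
    MeasureTheory.Integrable fun t : ℝ =>
      Complex.exp (-I * (t + I * δ) * z) / Complex.sinh (π * (t + I * δ)) :=
  MeasureTheory.Integrable.mono' (integrable_inv_one_add_sq.const_mul _)
    (aux_cont h0 h1 z).aestronglyMeasurable (Eventually.of_forall fun t => aux_bound h0 h1 z t)

lemma aux_vert (z a b : ℝ) (ha : 0 < a) (hb : 0 < b) {T : ℝ} (hT : 0 < T) (s : ℝ) (hs : |s| = T) :
    ‖∫ y in a..b, (fun w : ℂ => Complex.exp (-I * w * z) / Complex.sinh (π * w)) (s + y * I)‖ ≤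
      Real.exp ((a + b) * |z|) / T * |b - a| := by
  apply intervalIntegral.norm_integral_le_of_norm_le_const
  intro y hy
  rw [Set.uIoc, Set.mem_Ioc] at hy
  have hy0 : 0 < y := (lt_min ha hb).trans hy.1
  have hy1 : y ≤ a + b := hy.2.trans (max_le (by linarith) (by linarith))
  have e : (s : ℂ) + y * I = s + I * y := by ring
  simp only [e]
  rw [norm_div, aux_norm_exp]
  have h := aux_norm_sinh_ge' (π * (s + I * y))
  have e1 : ((π : ℂ) * (s + I * y)).re = π * s := by simp
  rw [e1] at h
  have h2 : T ≤ |Real.sinh (π * s)| := by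
    rw [Real.abs_sinh, abs_mul, hs, abs_of_pos pi_pos]
    have h3 : T ≤ π * T := by nlinarith [pi_gt_three]
    exact h3.trans (Real.self_le_sinh_iff.2 (hT.le.trans h3))
  refine div_le_div₀ (Real.exp_pos _).le (Real.exp_le_exp.2 ?_) hT (h2.trans h)
  nlinarith [le_abs_self z, abs_nonneg z]

lemma aux_shift {a b : ℝ} (ha0 : 0 < a) (ha1 : a < 1) (hb0 : 0 < b) (hb1 : b < 1) (z : ℝ) :
    ∫ t : ℝ, Complex.exp (-I * (t + I * a) * z) / Complex.sinh (π * (t + I * a)) =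
    ∫ t : ℝ, Complex.exp (-I * (t + I * b) * z) / Complex.sinh (π * (t + I * b)) := by
  set f : ℂ → ℂ := fun w => Complex.exp (-I * w * z) / Complex.sinh (π * w) with hf
  have hrect : ∀ T : ℝ, (∫ x : ℝ in (-T)..T, f (x + a * I)) - (∫ x : ℝ in (-T)..T, f (x + b * I)) =
      I • (∫ y : ℝ in a..b, f (((-T : ℝ) : ℂ) + y * I)) - I • (∫ y : ℝ in a..b, f (T + y * I)) := by
    intro T
    have := Complex.integral_boundary_rect_eq_zero_of_differentiableOn f (⟨-T, a⟩ : ℂ) (⟨T, b⟩ : ℂ) ?_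
    · simp only at this
      linear_combination this
    · intro w hw
      have hw2 := hw.2
      simp only [Set.mem_preimage, Set.uIcc, Set.mem_Icc] at hw2
      have hi0 : 0 < w.im := (lt_min ha0 hb0).trans_le hw2.1
      have hi1 : w.im < 1 := hw2.2.trans_lt (max_lt ha1 hb1)
      have hne := aux_sinh_ne hi0 hi1 w.re
      have e : (w.re : ℂ) + I * w.im = w := by rw [mul_comm]; exact Complex.re_add_im w
      rw [e] at hne
      apply DifferentiableAt.differentiableWithinAt
      refine DifferentiableAt.div (by fun_prop) ?_ hne
      exact (Complex.differentiable_sinh _).comp w (by fun_prop)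
  have hcommA : ∀ t : ℝ, f (t + a * I) = Complex.exp (-I * (t + I * a) * z) / Complex.sinh (π * (t + I * a)) := by
    intro t; simp only [hf]; rw [mul_comm (a : ℂ) I]
  have hcommB : ∀ t : ℝ, f (t + b * I) = Complex.exp (-I * (t + I * b) * z) / Complex.sinh (π * (t + I * b)) := by
    intro t; simp only [hf]; rw [mul_comm (b : ℂ) I]
  simp_rw [hcommA, hcommB] at hrect
  have tA := MeasureTheory.intervalIntegral_tendsto_integral (aux_int ha0 ha1 z)
    tendsto_neg_atTop_atBot tendsto_id
  have tB := MeasureTheory.intervalIntegral_tendsto_integral (aux_int hb0 hb1 z)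
    tendsto_neg_atTop_atBot tendsto_id
  have tD := tA.sub tB
  have hz : Tendsto (fun T : ℝ => 2 * (Real.exp ((a + b) * |z|) / T * |b - a|)) atTop (nhds 0) := by
    have : Tendsto (fun T : ℝ => Real.exp ((a + b) * |z|) / T) atTop (nhds 0) :=
      tendsto_const_nhds.div_atTop tendsto_id
    simpa using (this.mul_const |b - a|).const_mul 2
  have t0 := squeeze_zero_norm' (f := fun T : ℝ => I • (∫ y : ℝ in a..b, f (((-T : ℝ) : ℂ) + y * I)) -
      I • (∫ y : ℝ in a..b, f (T + y * I))) (a := fun T : ℝ => 2 * (Real.exp ((a + b) * |z|) / T * |b - a|)) (t₀ := atTop) ?_ hz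
  · have t1 := t0.congr (fun T => (hrect T).symm)
    exact sub_eq_zero.1 (tendsto_nhds_unique tD t1)
  · filter_upwards [eventually_gt_atTop 0] with T hT
    refine (norm_sub_le _ _).trans ?_
    rw [norm_smul, norm_smul, Complex.norm_I, one_mul, one_mul, two_mul]
    exact add_le_add (aux_vert z a b ha0 hb0 hT _ (by rw [abs_neg, abs_of_pos hT]))
      (aux_vert z a b ha0 hb0 hT _ (by rw [abs_of_pos hT]))

lemma aux_J {δ : ℝ} (h0 : 0 < δ) (h1 : δ < 1) (z : ℝ) :
    ∫ t : ℝ, Complex.exp (-I * (t + I * δ) * z) / Complex.sinh (π * (t + I * δ)) =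
      -2 * I * (Real.exp z / (1 + Real.exp z) : ℝ) := by
  rw [aux_shift h0 h1 (b := 1 / 2) (by norm_num) (by norm_num)]
  have hpt : ∀ t : ℝ, Complex.exp (-I * (t + I * ((1 / 2 : ℝ) : ℂ)) * z) /
      Complex.sinh (π * (t + I * ((1 / 2 : ℝ) : ℂ))) =
      (-I * Complex.exp (z / 2)) * (Complex.exp (-I * t * z) / Complex.cosh (π * t)) := by
    intro t
    have e1 : -I * (t + I * ((1 / 2 : ℝ) : ℂ)) * z = z / 2 + -I * t * z := by
      push_cast; linear_combination (-z / 2 : ℂ) * Complex.I_sq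
    have e2 : (π : ℂ) * (t + I * ((1 / 2 : ℝ) : ℂ)) = π * t + (π / 2) * I := by push_cast; ring
    rw [e1, e2, Complex.exp_add, Complex.sinh_add, Complex.sinh_mul_I, Complex.cosh_mul_I,
      Complex.sin_pi_div_two, Complex.cos_pi_div_two, mul_zero, zero_add, one_mul,
      mul_comm (Complex.cosh _) I, ← div_div, div_right_comm, Complex.div_I]
    ring
  simp_rw [hpt]
  rw [MeasureTheory.integral_const_mul, aux_sech, Complex.cosh]
  push_cast
  have e3 : Complex.exp (z : ℂ) = Complex.exp (z / 2) * Complex.exp (z / 2) := by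
    rw [← Complex.exp_add]; ring_nf
  have hr : (1 : ℂ) + Complex.exp z ≠ 0 := by
    have : (1 + Real.exp z : ℝ) ≠ 0 := by positivity
    exact_mod_cast this
  rw [Complex.exp_neg]
  have hne := Complex.exp_ne_zero ((z : ℂ) / 2)
  rw [e3] at hr ⊢
  have hr2 : Complex.exp ((z : ℂ) / 2) + (Complex.exp ((z : ℂ) / 2))⁻¹ ≠ 0 := by
    intro h
    apply hr
    have := congrArg (· * Complex.exp ((z : ℂ) / 2)) h
    simp only [add_mul, inv_mul_cancel₀ hne, zero_mul] at this
    rw [add_comm]; exact this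
  generalize Complex.exp ((z : ℂ) / 2) = E at *
  have : E + E⁻¹ = (1 + E * E) / E := by field_simp; ring
  rw [this]
  field_simp

/-- the limit integral -/
noncomputable def auxL (δ z : ℝ) : ℂ :=
  -(1 / 2) * ∫ t : ℝ, Complex.exp (-I * (t + I * δ) * z) / Complex.sinh (π * (t + I * δ)) / (t + I * δ)

lemma aux_w_lower {δ : ℝ} (h0 : 0 < δ) (t : ℝ) : δ ≤ ‖(t : ℂ) + I * δ‖ := by
  have := Complex.abs_im_le_norm ((t : ℂ) + I * δ)
  simp only [add_im, ofReal_im, mul_im, I_re, I_im, ofReal_re, zero_mul, one_mul, zero_add] at this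
  rwa [abs_of_pos h0] at this

lemma aux_w_ne {δ : ℝ} (h0 : 0 < δ) (t : ℝ) : (t : ℂ) + I * δ ≠ 0 :=
  norm_pos_iff.1 (h0.trans_le (aux_w_lower h0 t))

lemma aux_bound2 {δ : ℝ} (h0 : 0 < δ) (h1 : δ < 1) (z t : ℝ) :
    ‖Complex.exp (-I * (t + I * δ) * z) / Complex.sinh (π * (t + I * δ)) / (t + I * δ)‖ ≤
      Real.exp (δ * z) * ((Real.sin (π * δ))⁻¹ * δ⁻¹ * (1 + t ^ 2)⁻¹) := by
  have hs := aux_sin_pos h0 h1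
  rw [norm_div]
  calc _ ≤ (Real.exp (δ * z) / Real.sin (π * δ) * (1 + t ^ 2)⁻¹) / δ :=
        div_le_div₀ (by positivity) (aux_bound h0 h1 z t) h0 (aux_w_lower h0 t)
    _ = _ := by ring

lemma aux_cont2 {δ : ℝ} (h0 : 0 < δ) (h1 : δ < 1) (z : ℝ) :
    Continuous fun t : ℝ => Complex.exp (-I * (t + I * δ) * z) / Complex.sinh (π * (t + I * δ)) / (t + I * δ) :=
  (aux_cont h0 h1 z).div (by fun_prop) (fun t => aux_w_ne h0 t)

lemma aux_int2 {δ : ℝ} (h0 : 0 < δ) (h1 : δ < 1) (z : ℝ) :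
    MeasureTheory.Integrable fun t : ℝ =>
      Complex.exp (-I * (t + I * δ) * z) / Complex.sinh (π * (t + I * δ)) / (t + I * δ) :=
  MeasureTheory.Integrable.mono' ((integrable_inv_one_add_sq.const_mul _).const_mul _)
    (aux_cont2 h0 h1 z).aestronglyMeasurable (Eventually.of_forall fun t => aux_bound2 h0 h1 z t)

lemma auxL_bound {δ : ℝ} (h0 : 0 < δ) (h1 : δ < 1) :
    ∃ C : ℝ, ∀ z, ‖auxL δ z‖ ≤ Real.exp (δ * z) * C := by
  refine ⟨1 / 2 * ∫ t : ℝ, ((Real.sin (π * δ))⁻¹ * δ⁻¹ * (1 + t ^ 2)⁻¹), fun z => ?_⟩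
  rw [auxL, norm_mul]
  have h := MeasureTheory.norm_integral_le_of_norm_le
    ((integrable_inv_one_add_sq.const_mul ((Real.sin (π * δ))⁻¹ * δ⁻¹)).const_mul (Real.exp (δ * z)))
    (Eventually.of_forall fun t => aux_bound2 h0 h1 z t)
  rw [MeasureTheory.integral_const_mul] at h
  have e : ‖(-(1 / 2) : ℂ)‖ = 1 / 2 := by norm_num
  rw [e]
  linarith

lemma auxL_deriv {δ : ℝ} (h0 : 0 < δ) (h1 : δ < 1) (z : ℝ) :
    HasDerivAt (fun z => auxL δ z) ((Real.exp z / (1 + Real.exp z) : ℝ) : ℂ) z := by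
  have hs := aux_sin_pos h0 h1
  have h := hasDerivAt_integral_of_dominated_loc_of_deriv_le (μ := MeasureTheory.volume) (𝕜 := ℝ)
    (F := fun (z t : ℝ) => Complex.exp (-I * (t + I * δ) * z) / Complex.sinh (π * (t + I * δ)) / (t + I * δ))
    (F' := fun (z t : ℝ) => -I * (Complex.exp (-I * (t + I * δ) * z) / Complex.sinh (π * (t + I * δ))))
    (x₀ := z) (s := Set.Iio (z + 1))
    (bound := fun t => Real.exp (δ * (z + 1)) / Real.sin (π * δ) * (1 + t ^ 2)⁻¹)
    (Iio_mem_nhds (by linarith))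
    (Eventually.of_forall fun x => (aux_cont2 h0 h1 x).aestronglyMeasurable)
    (aux_int2 h0 h1 z)
    ((aux_cont h0 h1 z).const_mul _ |>.aestronglyMeasurable)
    (Eventually.of_forall fun t x hx => ?_)
    (integrable_inv_one_add_sq.const_mul _)
    (Eventually.of_forall fun t x hx => ?_)
  · have h2 := h.2.const_mul (-(1 / 2) : ℂ)
    rw [MeasureTheory.integral_const_mul, aux_J h0 h1] at h2
    refine h2.congr_deriv ?_
    generalize ((Real.exp z / (1 + Real.exp z) : ℝ) : ℂ) = A
    linear_combination (-A) * Complex.I_sq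
  · rw [norm_mul, norm_neg, Complex.norm_I, one_mul]
    refine (aux_bound h0 h1 x t).trans ?_
    have : δ * x ≤ δ * (z + 1) := mul_le_mul_of_nonneg_left (le_of_lt hx) h0.le
    gcongr
  · have hw := aux_w_ne h0 t
    have hsn := aux_sinh_ne h0 h1 t
    have hd : HasDerivAt (fun x : ℝ => -I * ((t : ℂ) + I * δ) * (x : ℂ)) (-I * (t + I * δ)) x := by
      simpa using (Complex.ofRealCLM.hasDerivAt (x := x)).const_mul (-I * ((t : ℂ) + I * δ))
    have := ((hd.cexp).div_const (Complex.sinh (π * (t + I * δ)))).div_const ((t : ℂ) + I * δ)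
    refine this.congr_deriv ?_
    field_simp

lemma auxL_eq {δ : ℝ} (h0 : 0 < δ) (h1 : δ < 1) (z : ℝ) :
    auxL δ z = (Real.log (1 + Real.exp z) : ℂ) := by
  have hd : ∀ x : ℝ, HasDerivAt (fun x => auxL δ x - (Real.log (1 + Real.exp x) : ℂ)) 0 x := by
    intro x
    have h2 : HasDerivAt (fun x : ℝ => Real.log (1 + Real.exp x)) (Real.exp x / (1 + Real.exp x)) x :=
      ((Real.hasDerivAt_exp x).const_add 1).log (by positivity)
    exact ((auxL_deriv h0 h1 x).sub h2.ofReal_comp).congr_deriv (sub_self _)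
  have hc : ∀ x, auxL δ x - (Real.log (1 + Real.exp x) : ℂ) = auxL δ z - (Real.log (1 + Real.exp z) : ℂ) :=
    fun x => is_const_of_deriv_eq_zero (fun x => (hd x).differentiableAt) (fun x => (hd x).deriv) x z
  obtain ⟨C, hC⟩ := auxL_bound h0 h1
  have t1 : Tendsto (fun x => auxL δ x) atBot (nhds 0) := by
    refine squeeze_zero_norm hC ?_
    have : Tendsto (fun x : ℝ => Real.exp (δ * x)) atBot (nhds 0) :=
      Real.tendsto_exp_atBot.comp (tendsto_id.const_mul_atBot h0)
    simpa using this.mul_const C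
  have t2 : Tendsto (fun x => (Real.log (1 + Real.exp x) : ℂ)) atBot (nhds 0) := by
    have h3 : Tendsto (fun x : ℝ => 1 + Real.exp x) atBot (nhds 1) := by
      simpa using Real.tendsto_exp_atBot.const_add 1
    have := (Real.continuousAt_log one_ne_zero).tendsto.comp h3
    rw [Real.log_one] at this
    exact_mod_cast (Complex.continuous_ofReal.tendsto 0).comp this
  have t3 := t1.sub t2
  simp_rw [hc] at t3
  have := tendsto_nhds_unique t3 tendsto_const_nhds
  rw [sub_zero] at this
  exact sub_eq_zero.1 this.symm

/-- Classical limit of the quantum logarithm: `lim_{h→0⁺} φ^h(z) = log(1 + e^z)`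
for each fixed real `z`. -/
theorem qlog_tendsto_log_one_add_exp (δ z : ℝ) (hδ0 : 0 < δ) (hδ1 : δ < 1) :
    Tendsto (fun h : ℝ => qlog h δ z) (nhdsWithin 0 (Set.Ioi 0))
      (nhds ((Real.log (1 + Real.exp z) : ℂ))) := by
  rw [← auxL_eq hδ0 hδ1 z, auxL, ← MeasureTheory.integral_const_mul]
  simp_rw [qlog, ← MeasureTheory.integral_const_mul]
  have hsn := aux_sin_pos hδ0 hδ1
  have hform : ∀ h t : ℝ, -((π : ℂ) * h / 2) * qlogIntegrand h δ z t =
      -(1 / 2) * ((Complex.exp (-I * (t + I * δ) * z) / Complex.sinh (π * (t + I * δ))) *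
        (π * h / Complex.sinh (π * h * (t + I * δ)))) := by
    intro h t
    rw [qlogIntegrand, ← div_div]; ring
  refine MeasureTheory.tendsto_integral_filter_of_dominated_convergence
    (fun t => 1 / 2 * ((Real.exp (δ * z) / Real.sin (π * δ) * (1 + t ^ 2)⁻¹) * (π / (2 * δ)))) ?_ ?_ ?_ ?_
  · refine Eventually.of_forall fun h => Measurable.aestronglyMeasurable ?_
    unfold qlogIntegrand
    fun_prop
  · have hmem : Set.Ioo (0 : ℝ) (1 / (2 * δ)) ∈ nhdsWithin (0 : ℝ) (Set.Ioi 0) :=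
      Ioo_mem_nhdsGT (by positivity)
    filter_upwards [hmem] with h hh
    refine Eventually.of_forall fun t => ?_
    rw [hform, norm_mul, norm_mul]
    have e : ‖(-(1 / 2) : ℂ)‖ = 1 / 2 := by norm_num
    rw [e]
    refine mul_le_mul_of_nonneg_left ?_ (by norm_num)
    refine mul_le_mul (aux_bound hδ0 hδ1 z t) ?_ (norm_nonneg _) (by positivity)
    have hh0 : 0 < h := hh.1
    have hh1 : h * (2 * δ) < 1 := (lt_div_iff₀ (by positivity)).1 hh.2
    have h1 := aux_norm_sinh_ge (π * h * (t + I * δ))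
    have e2 : ((π : ℂ) * h * (t + I * δ)).im = π * h * δ := by
      have : (π : ℂ) * h * (t + I * δ) = ((π * h * t : ℝ) : ℂ) + ((π * h * δ : ℝ) : ℂ) * I := by
        push_cast; ring
      rw [this, add_im, ofReal_im, Complex.im_ofReal_mul, I_im]; ring
    rw [e2] at h1
    have h2 := Real.mul_le_sin (x := π * h * δ) (by positivity) (by nlinarith [pi_pos])
    have h3 : 2 / π * (π * h * δ) = 2 * h * δ := by field_simp
    rw [h3] at h2
    have h4 : 2 * h * δ ≤ ‖Complex.sinh (π * h * (t + I * δ))‖ := by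
      refine (h2.trans (le_abs_self _)).trans (le_trans ?_ h1)
      exact le_mul_of_one_le_left (abs_nonneg _) (Real.one_le_cosh _)
    have e3 : ‖(π : ℂ) * h‖ = π * h := by
      rw [← Complex.ofReal_mul, Complex.norm_real, Real.norm_of_nonneg (by positivity)]
    rw [norm_div, e3]
    calc π * h / ‖Complex.sinh (π * h * (t + I * δ))‖ ≤ π * h / (2 * h * δ) :=
          div_le_div_of_nonneg_left (by positivity) (by positivity) h4
      _ = π / (2 * δ) := by field_simp
  · exact ((integrable_inv_one_add_sq.const_mul _).mul_const _).const_mul _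
  · refine Eventually.of_forall fun t => ?_
    simp_rw [hform]
    refine Tendsto.const_mul _ ?_
    rw [div_eq_mul_inv _ ((t : ℂ) + I * δ)]
    refine Tendsto.const_mul _ ?_
    have hw := aux_w_ne hδ0 t
    have hpi : (π : ℂ) ≠ 0 := by exact_mod_cast pi_ne_zero
    have hd : HasDerivAt (fun h : ℝ => (π : ℂ) * h * (t + I * δ)) (π * (t + I * δ)) 0 := by
      have := ((Complex.ofRealCLM.hasDerivAt (x := (0 : ℝ))).const_mul (π : ℂ)).mul_const ((t : ℂ) + I * δ)
      refine this.congr_deriv ?_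
      simp
    have hd2 : HasDerivAt (fun h : ℝ => Complex.sinh ((π : ℂ) * h * (t + I * δ))) (π * (t + I * δ)) 0 := by
      have := (Complex.hasDerivAt_sinh _).comp (0 : ℝ) hd
      refine this.congr_deriv ?_
      simp
    have ht := (hd2.tendsto_slope_zero_right.inv₀ (mul_ne_zero hpi hw)).const_mul (π : ℂ)
    have e4 : (π : ℂ) * (π * (t + I * δ))⁻¹ = ((t : ℂ) + I * δ)⁻¹ := by
      field_simp
    rw [e4] at ht
    refine ht.congr fun h => ?_
    simp only [zero_add, ofReal_zero, mul_zero, zero_mul, Complex.sinh_zero, sub_zero,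
      Complex.real_smul, ofReal_inv, mul_inv, inv_inv]
    ring

end Stmt5
end

section
/- The quantum dilogarithm Φ^h(z) = exp(−(1/4) ∫_Ω e^{−itz}/(sinh(πt) sinh(πht)) dt/t) satisfies the inversion relation Φ^h(z)·Φ^h(−z) = exp(z²/(4πih))·exp(−(πi/12)(h + h⁻¹)) for all real z and h > 0. -/
namespace Stmt7

open Real Complex

/-- The exponent of the quantum dilogarithm,
`−(1/4) ∫_Ω e^{−itz}/(sinh(πt) sinh(πht)) dt/t`, with the contour `Ω` along the real
axis bypassing the origin from above realized as the horizontal line `ℝ + iδ`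
(for `0 < δ < min(1, 1/h)` no pole of the integrand lies between the two contours). -/
noncomputable def qdilogExponent (h δ z : ℝ) : ℂ :=
  -(1 / 4) * ∫ t : ℝ,
    Complex.exp (-Complex.I * (t + Complex.I * δ) * z) /
      (Complex.sinh (Real.pi * (t + Complex.I * δ)) *
        Complex.sinh (Real.pi * h * (t + Complex.I * δ)) * (t + Complex.I * δ))

/-- The quantum dilogarithm `Φ^h(z) = exp(−(1/4) ∫_Ω e^{−itz}/(sinh(πt) sinh(πht)) dt/t)`. -/
noncomputable def qdilog (h δ z : ℝ) : ℂ := Complex.exp (qdilogExponent h δ z)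


open Filter Topology MeasureTheory in
lemma aux_factor (N : ℂ → ℂ) (U : Set ℂ) (hU : U ∈ 𝓝 (0:ℂ)) (hN : DifferentiableOn ℂ N U) (C : ℂ)
    (hC : Tendsto (fun t => (N t - N 0) / t ^ 2) (𝓝[≠] 0) (𝓝 C)) :
    ∃ g : ℂ → ℂ, DifferentiableOn ℂ g U ∧ ∀ t, t ≠ 0 → g t = N t / t ^ 3 - N 0 / t ^ 3 - C / t := by
  have h1 : DifferentiableOn ℂ (dslope N 0) U := (Complex.differentiableOn_dslope hU).2 hN
  have h2 : DifferentiableOn ℂ (dslope (dslope N 0) 0) U := (Complex.differentiableOn_dslope hU).2 h1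
  have h3 := (Complex.differentiableOn_dslope hU).2 h2
  have e1 : ∀ t, t ≠ 0 → dslope N 0 t = (N t - N 0) / t := fun t ht => by
    rw [dslope_of_ne _ ht, slope_def_field, sub_zero]
  have z1 : dslope N 0 0 = 0 := by
    have c1 : Tendsto (dslope N 0) (𝓝[≠] 0) (𝓝 (dslope N 0 0)) :=
      (h1.continuousOn.continuousAt hU).tendsto.mono_left nhdsWithin_le_nhds
    have c2 : Tendsto (fun t : ℂ => t * ((N t - N 0) / t ^ 2)) (𝓝[≠] 0) (𝓝 (0 * C)) :=
      (tendsto_id.mono_left nhdsWithin_le_nhds).mul hC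
    rw [zero_mul] at c2
    refine tendsto_nhds_unique c1 (c2.congr' ?_)
    filter_upwards [self_mem_nhdsWithin] with t ht
    have ht : t ≠ 0 := ht
    rw [e1 t ht]; field_simp
  have e2 : ∀ t, t ≠ 0 → dslope (dslope N 0) 0 t = (N t - N 0) / t ^ 2 := fun t ht => by
    rw [dslope_of_ne _ ht, slope_def_field, sub_zero, z1, e1 t ht]; field_simp; simp
  have z2 : dslope (dslope N 0) 0 0 = C := by
    have c1 : Tendsto (dslope (dslope N 0) 0) (𝓝[≠] 0) (𝓝 (dslope (dslope N 0) 0 0)) :=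
      (h2.continuousOn.continuousAt hU).tendsto.mono_left nhdsWithin_le_nhds
    refine tendsto_nhds_unique c1 (hC.congr' ?_)
    filter_upwards [self_mem_nhdsWithin] with t ht
    exact (e2 t ht).symm
  refine ⟨_, h3, fun t ht => ?_⟩
  rw [dslope_of_ne _ ht, slope_def_field, sub_zero, z2, e2 t ht]; field_simp

open Filter Topology MeasureTheory in
lemma aux_log (δ : ℝ) (hδ : 0 < δ) :
    Tendsto (fun R : ℝ => Complex.log (-I * (R + I * δ)) - Complex.log (-I * (-R + I * δ)))
      atTop (𝓝 (-(π * I))) := by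
  have h1 : Tendsto (fun R : ℝ => ((δ / R : ℝ) : ℂ)) atTop (𝓝 0) := by
    have : Tendsto (fun R : ℝ => δ / R) atTop (𝓝 0) := tendsto_const_nhds.div_atTop tendsto_id
    exact_mod_cast (Complex.continuous_ofReal.tendsto 0).comp this
  have c1 : Tendsto (fun R : ℝ => Complex.log ((δ / R : ℝ) + -I)) atTop (𝓝 (Complex.log (0 + -I))) :=
    (h1.add_const _).clog (by simp [Complex.mem_slitPlane_iff])
  have c2 : Tendsto (fun R : ℝ => Complex.log ((δ / R : ℝ) + I)) atTop (𝓝 (Complex.log (0 + I))) :=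
    (h1.add_const _).clog (by simp [Complex.mem_slitPlane_iff])
  have := c1.sub c2
  rw [zero_add, zero_add, Complex.log_neg_I, Complex.log_I] at this
  have e : -((π:ℂ) / 2) * I - (π:ℂ) / 2 * I = -(π * I) := by ring
  rw [e] at this
  refine this.congr' ?_
  filter_upwards [eventually_gt_atTop 0] with R hR
  have hR' : (R:ℂ) ≠ 0 := by exact_mod_cast hR.ne'
  have a1 : -I * (R + I * δ) = (R:ℂ) * ((δ / R : ℝ) + -I) := by
    push_cast; field_simp; ring_nf; simp
  have a2 : -I * (-R + I * δ) = (R:ℂ) * ((δ / R : ℝ) + I) := by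
    push_cast; field_simp; ring_nf; simp
  have n1 : ((δ / R : ℝ) : ℂ) + -I ≠ 0 := fun h => by
    have := congrArg Complex.im h; simp at this
  have n2 : ((δ / R : ℝ) : ℂ) + I ≠ 0 := fun h => by
    have := congrArg Complex.im h; simp at this
  rw [a1, a2, Complex.log_ofReal_mul hR n1, Complex.log_ofReal_mul hR n2]
  ring

open Filter Topology MeasureTheory in
lemma aux_shift (N : ℂ → ℂ) (m δ : ℝ) (hδ : 0 < δ) (hm : δ < m) (heven : ∀ t, N (-t) = N t)
    (hN : DifferentiableOn ℂ N {t | |t.im| < m}) (D : ℝ) 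
    (hD : ∀ t : ℂ, 1 ≤ |t.re| → |t.im| ≤ δ → ‖N t / t ^ 3‖ ≤ D / |t.re|)
    (hint : Integrable (fun x : ℝ => N (x + I * δ) / (x + I * δ) ^ 3)) (C : ℂ)
    (hC : Tendsto (fun t => (N t - N 0) / t ^ 2) (𝓝[≠] 0) (𝓝 C)) :
    ∫ x : ℝ, N (x + I * δ) / (x + I * δ) ^ 3 = -(π * I) * C := by
  have hUo : IsOpen {t : ℂ | |t.im| < m} := isOpen_lt (by fun_prop) continuous_const
  have hU : {t : ℂ | |t.im| < m} ∈ 𝓝 (0:ℂ) := hUo.mem_nhds (by simp; linarith)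
  obtain ⟨g, hg, hge⟩ := aux_factor N _ hU hN C hC
  have hne : ∀ x : ℝ, (x + I * δ : ℂ) ≠ 0 := fun x h => by
    have := congrArg Complex.im h; simp at this; linarith
  -- finite integrals
  have hlim := intervalIntegral_tendsto_integral hint tendsto_neg_atTop_atBot tendsto_id
  refine tendsto_nhds_unique hlim ?_
  -- odd part
  have hodd : ∀ R : ℝ, ∫ x : ℝ in (-R)..R, g x = 0 := by
    intro R
    have h1 : ∫ x : ℝ in (-R)..R, g ((-x : ℝ)) = ∫ x : ℝ in (-R)..R, g x := by
      have := intervalIntegral.integral_comp_neg (a := -R) (b := R) (fun x : ℝ => g x)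
      simpa using this
    have h2 : ∫ x : ℝ in (-R)..R, g ((-x : ℝ)) = ∫ x : ℝ in (-R)..R, -g x := by
      refine intervalIntegral.integral_congr_ae ?_
      filter_upwards [Measure.ae_ne volume (0:ℝ)] with x hx _
      have hx : (x:ℂ) ≠ 0 := by exact_mod_cast hx
      push_cast
      rw [hge _ (neg_ne_zero.2 hx), hge _ hx, heven]
      field_simp; ring
    rw [intervalIntegral.integral_neg] at h2
    have h3 := h1.symm.trans h2
    exact CharZero.eq_neg_self_iff.mp h3
  have hcg : ContinuousOn g {t | |t.im| < m} := hg.continuousOn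
  have hcline : Continuous (fun x : ℝ => g (x + I * δ)) := by
    refine hcg.comp_continuous (by fun_prop) (fun x => ?_)
    simp [abs_of_pos hδ, hm]
  have hrect : ∀ R : ℝ, ∫ x : ℝ in (-R)..R, g (x + I * δ) =
      I * (∫ y : ℝ in (0:ℝ)..δ, g (R + y * I)) - I * ∫ y : ℝ in (0:ℝ)..δ, g (-R + y * I) := by
    intro R
    have := Complex.integral_boundary_rect_eq_zero_of_differentiableOn g (-R : ℝ) (R + δ * I)
      (hg.mono ?_)
    · simp only [ofReal_re, ofReal_im, add_re, add_im, mul_re, mul_im, I_re, I_im, mul_zero, mul_one,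
        zero_mul, sub_zero, add_zero, zero_add, ofReal_zero, smul_eq_mul, hodd] at this
      push_cast at this
      have e : ∀ x : ℝ, (x + I * δ : ℂ) = x + δ * I := fun x => by ring
      simp only [e]
      linear_combination -this
    · intro t ht
      have := (Complex.mem_reProdIm.1 ht).2
      simp [Set.uIcc_of_le hδ.le] at this
      show |t.im| < m
      rw [abs_of_nonneg this.1]; linarith
  -- vertical bounds
  have hvert : ∀ s : ℝ, |s| = 1 → Tendsto (fun R : ℝ => ∫ y : ℝ in (0:ℝ)..δ, g ((s * R : ℝ) + y * I)) atTop (𝓝 0) := by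
    intro s hs
    have hz : Tendsto (fun R : ℝ => ((D + ‖N 0‖ + ‖C‖) / R) * |δ - 0|) atTop (𝓝 0) := by
      have : Tendsto (fun R : ℝ => ((D + ‖N 0‖ + ‖C‖) / R)) atTop (𝓝 0) :=
        tendsto_const_nhds.div_atTop tendsto_id
      simpa using this.mul_const |δ - 0|
    refine squeeze_zero_norm' ?_ hz
    filter_upwards [eventually_ge_atTop 1] with R hR
    refine intervalIntegral.norm_integral_le_of_norm_le_const (fun y hy => ?_)
    rw [Set.uIoc_of_le hδ.le] at hy
    set t : ℂ := (s * R : ℝ) + y * I with ht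
    have hre : |t.re| = R := by simp [ht, abs_mul, hs]; linarith
    have him : t.im = y := by simp [ht]
    have htn : R ≤ ‖t‖ := hre ▸ Complex.abs_re_le_norm t
    have ht0 : t ≠ 0 := norm_pos_iff.1 (by linarith)
    have b1 := hD t (by rw [hre]; exact hR) (by rw [him, abs_of_pos hy.1]; exact hy.2)
    rw [hre] at b1
    have b2 : ‖N 0 / t ^ 3‖ ≤ ‖N 0‖ / R := by
      rw [norm_div, norm_pow]
      gcongr
      calc R ≤ ‖t‖ := htn
        _ = ‖t‖ ^ 1 := (pow_one _).symm
        _ ≤ ‖t‖ ^ 3 := pow_le_pow_right₀ (by linarith) (by norm_num)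
    have b3 : ‖C / t‖ ≤ ‖C‖ / R := by
      rw [norm_div]; gcongr
    rw [hge t ht0]
    calc _ ≤ ‖N t / t ^ 3‖ + ‖N 0 / t ^ 3‖ + ‖C / t‖ := (norm_sub_le _ _).trans (by gcongr; exact norm_sub_le _ _)
      _ ≤ D / R + ‖N 0‖ / R + ‖C‖ / R := by gcongr
      _ = _ := by ring
  -- primitive
  have hprim : ∀ R : ℝ, ∫ x : ℝ in (-R)..R, (N 0 / (x + I * δ) ^ 3 + C / (x + I * δ)) =
      (-(N 0 / 2) * ((R + I * δ) ^ 2)⁻¹ + C * Complex.log (-I * (R + I * δ))) -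
      (-(N 0 / 2) * ((((-R : ℝ) : ℂ) + I * δ) ^ 2)⁻¹ + C * Complex.log (-I * (((-R : ℝ) : ℂ) + I * δ))) := by
    intro R
    refine intervalIntegral.integral_eq_sub_of_hasDerivAt
      (f := fun x : ℝ => (-(N 0 / 2) * ((x + I * δ) ^ 2)⁻¹ + C * Complex.log (-I * (x + I * δ)))) (fun x _ => ?_) ?_
    · have d0 : HasDerivAt (fun x : ℝ => (x + I * δ : ℂ)) 1 x :=
        (Complex.ofRealCLM.hasDerivAt (x := x)).add_const (I * (δ:ℂ))
      have d1 := ((d0.pow 2).inv (pow_ne_zero 2 (hne x))).const_mul (-(N 0 / 2))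
      have d2 := ((d0.const_mul (-I)).clog_real (by
        exact Or.inl (by simp [hδ]))).const_mul C
      refine (d1.add d2).congr_deriv ?_
      have := hne x
      field_simp
      norm_num
      ring
    · refine Continuous.intervalIntegrable ?_ _ _
      refine (Continuous.div (by fun_prop) (by fun_prop) fun x => pow_ne_zero 3 (hne x)).add
        (Continuous.div (by fun_prop) (by fun_prop) hne)
  have hci : Continuous (fun x : ℝ => N 0 / (x + I * δ : ℂ) ^ 3 + C / (x + I * δ)) :=
      (Continuous.div (by fun_prop) (by fun_prop) fun x => pow_ne_zero 3 (hne x)).add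
        (Continuous.div (by fun_prop) (by fun_prop) hne)
  have hfin : ∀ R : ℝ, ∫ x : ℝ in (-R)..R, N (x + I * δ) / (x + I * δ) ^ 3 =
      (-(N 0 / 2) * ((R + I * δ) ^ 2)⁻¹ + C * Complex.log (-I * (R + I * δ))) -
      (-(N 0 / 2) * ((((-R : ℝ) : ℂ) + I * δ) ^ 2)⁻¹ + C * Complex.log (-I * (((-R : ℝ) : ℂ) + I * δ))) +
      (I * (∫ y : ℝ in (0:ℝ)..δ, g (R + y * I)) - I * ∫ y : ℝ in (0:ℝ)..δ, g (-R + y * I)) := by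
    intro R
    rw [← hprim, ← hrect, ← intervalIntegral.integral_add (hci.intervalIntegrable _ _) (hcline.intervalIntegrable _ _)]
    refine intervalIntegral.integral_congr (fun x _ => ?_)
    simp only [hge _ (hne x)]
    ring
  have hsq : ∀ s : ℝ, |s| = 1 → Tendsto (fun R : ℝ => ((((s * R : ℝ) : ℂ) + I * δ) ^ 2)⁻¹) atTop (𝓝 0) := by
    intro s hs
    have hz : Tendsto (fun R : ℝ => 1 / R) atTop (𝓝 0) := tendsto_const_nhds.div_atTop tendsto_id
    refine squeeze_zero_norm' ?_ hz
    filter_upwards [eventually_ge_atTop 1] with R hR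
    set t : ℂ := ((s * R : ℝ) : ℂ) + I * δ with ht
    have hre : |t.re| = R := by simp [ht, abs_mul, hs]; linarith
    have htn : R ≤ ‖t‖ := hre ▸ Complex.abs_re_le_norm t
    rw [norm_inv, norm_pow, ← one_div]
    gcongr
    nlinarith
  have v1 := hvert 1 (by simp)
  have v2 := hvert (-1) (by simp)
  have s1 := hsq 1 (by simp)
  have s2 := hsq (-1) (by simp)
  simp only [one_mul, neg_mul] at v1 v2 s1 s2
  have L := aux_log δ hδ
  have total := (((s1.const_mul (-(N 0 / 2))).sub (s2.const_mul (-(N 0 / 2)))).add (L.const_mul C)).add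
    ((v1.const_mul I).sub (v2.const_mul I))
  have e : -(N 0 / 2) * 0 - -(N 0 / 2) * 0 + C * -(π * I) + (I * 0 - I * 0) = -(π * I) * C := by ring
  rw [e] at total
  refine total.congr (fun R => ?_)
  simp only [id]
  rw [hfin R]
  push_cast
  ring

open Filter Topology in
lemma aux_lim_one (f : ℂ → ℂ) (L : ℂ) (hf : Tendsto (fun w => (f w - 1) / w ^ 2) (𝓝[≠] 0) (𝓝 L)) :
    Tendsto f (𝓝[≠] 0) (𝓝 1) := by
  have h2 : Tendsto (fun w : ℂ => w ^ 2) (𝓝[≠] 0) (𝓝 0) := by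
    have : Tendsto (fun w : ℂ => w ^ 2) (𝓝 0) (𝓝 0) :=
      Continuous.tendsto' (by fun_prop) _ _ (by simp)
    exact this.mono_left nhdsWithin_le_nhds
  have h3 := (h2.mul hf).const_add 1
  rw [zero_mul, add_zero] at h3
  refine h3.congr' ?_
  filter_upwards [self_mem_nhdsWithin] with t ht
  have ht : t ≠ 0 := ht
  field_simp; ring

open Filter Topology in
lemma aux_lim_mul (f g : ℂ → ℂ) (L M : ℂ)
    (hf : Tendsto (fun w => (f w - 1) / w ^ 2) (𝓝[≠] 0) (𝓝 L))
    (hg : Tendsto (fun w => (g w - 1) / w ^ 2) (𝓝[≠] 0) (𝓝 M)) :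
    Tendsto (fun w => (f w * g w - 1) / w ^ 2) (𝓝[≠] 0) (𝓝 (L + M)) := by
  have := (hf.mul (aux_lim_one g M hg)).add hg
  rw [mul_one] at this
  refine this.congr (fun t => by ring)

open Filter Topology in
lemma aux_lim_inv (f : ℂ → ℂ) (L : ℂ)
    (hf : Tendsto (fun w => (f w - 1) / w ^ 2) (𝓝[≠] 0) (𝓝 L)) :
    Tendsto (fun w => ((f w)⁻¹ - 1) / w ^ 2) (𝓝[≠] 0) (𝓝 (-L)) := by
  have h1 := aux_lim_one f L hf
  have := (hf.div h1 one_ne_zero).neg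
  rw [div_one] at this
  refine this.congr' ?_
  filter_upwards [h1.eventually_ne one_ne_zero] with t ht
  by_cases h0 : t = 0
  · simp [h0]
  simp only [Pi.div_apply]
  field_simp; ring

open Filter Topology in
lemma aux_lim_scale (f : ℂ → ℂ) (L k : ℂ) (h0 : f 0 = 1)
    (hf : Tendsto (fun w => (f w - 1) / w ^ 2) (𝓝[≠] 0) (𝓝 L)) :
    Tendsto (fun w => (f (k * w) - 1) / w ^ 2) (𝓝[≠] 0) (𝓝 (k ^ 2 * L)) := by
  by_cases hk : k = 0
  · simp [hk, h0]
  have ht : Tendsto (fun w : ℂ => k * w) (𝓝[≠] 0) (𝓝[≠] 0) := by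
    refine tendsto_nhdsWithin_iff.2 ⟨?_, ?_⟩
    · have : Tendsto (fun w : ℂ => k * w) (𝓝 0) (𝓝 0) :=
        Continuous.tendsto' (by fun_prop) _ _ (by simp)
      exact this.mono_left nhdsWithin_le_nhds
    · filter_upwards [self_mem_nhdsWithin] with t ht
      exact mul_ne_zero hk ht
  refine ((hf.comp ht).const_mul (k ^ 2)).congr' ?_
  filter_upwards [self_mem_nhdsWithin] with t ht
  have ht : t ≠ 0 := ht
  simp only [Function.comp]
  field_simp

/-- The entire function `sinh w / w`. -/
noncomputable def shc (w : ℂ) : ℂ := dslope Complex.sinh 0 w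

lemma shc_mul (w : ℂ) : w * shc w = Complex.sinh w := by
  have := sub_smul_dslope Complex.sinh 0 w
  simpa [shc] using this

lemma shc_zero : shc 0 = 1 := by
  rw [shc, dslope_same, (Complex.hasDerivAt_sinh 0).deriv, Complex.cosh_zero]

lemma shc_neg (w : ℂ) : shc (-w) = shc w := by
  by_cases h : w = 0
  · simp [h]
  have h1 := shc_mul w
  have h2 := shc_mul (-w)
  rw [Complex.sinh_neg, ← h1] at h2
  exact mul_left_cancel₀ h (by linear_combination -h2)

lemma shc_diff : Differentiable ℂ shc := by
  rw [← differentiableOn_univ]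
  exact (Complex.differentiableOn_dslope Filter.univ_mem).2 Complex.differentiable_sinh.differentiableOn

open Filter Topology Asymptotics in
lemma aux_exp (c : ℂ) (n : ℕ) : Tendsto (fun w : ℂ => (Complex.exp (c * w) -
    ∑ i ∈ Finset.range (n+1), (c * w) ^ i / (i.factorial : ℂ)) / w ^ n) (𝓝[≠] 0) (𝓝 0) := by
  have h0 : Tendsto (fun w : ℂ => c * w) (𝓝 0) (𝓝 0) := Continuous.tendsto' (by fun_prop) _ _ (by simp)
  have h1 := (Complex.exp_sub_sum_range_isBigO_pow (n+1)).comp_tendsto h0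
  have h2 : (fun w : ℂ => (c * w) ^ (n+1)) =O[𝓝 0] (fun w => w ^ (n+1)) := by
    refine IsBigO.of_bound (‖c‖ ^ (n+1)) (Eventually.of_forall fun w => ?_)
    rw [mul_pow, norm_mul, norm_pow]
  have h3 : (fun w : ℂ => w ^ (n+1)) =o[𝓝 0] (fun w => w ^ n) := isLittleO_pow_pow n.lt_succ_self
  exact (((h1.trans h2).trans_isLittleO h3).mono nhdsWithin_le_nhds).tendsto_div_nhds_zero

open Filter Topology in
lemma shc_lim : Tendsto (fun w => (shc w - 1) / w ^ 2) (𝓝[≠] 0) (𝓝 (1 / 6)) := by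
  have h := (((aux_exp 1 3).sub (aux_exp (-1) 3)).const_mul (1 / 2)).add_const (1 / 6 : ℂ)
  simp only [sub_zero, mul_zero, zero_add] at h
  refine h.congr' ?_
  filter_upwards [self_mem_nhdsWithin] with t ht
  have ht : t ≠ 0 := ht
  have e : shc t = Complex.sinh t / t := by rw [← shc_mul t]; field_simp
  rw [e, Complex.sinh]
  simp [Finset.sum_range_succ, Nat.factorial]
  field_simp
  ring

open Filter Topology in
lemma cos_lim : Tendsto (fun w => (Complex.cos w - 1) / w ^ 2) (𝓝[≠] 0) (𝓝 (-1 / 2)) := by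
  have h := (((aux_exp I 2).add (aux_exp (-I) 2)).const_mul (1 / 2)).add_const (-1 / 2 : ℂ)
  simp only [add_zero, mul_zero, zero_add] at h
  refine h.congr' ?_
  filter_upwards [self_mem_nhdsWithin] with t ht
  have ht : t ≠ 0 := ht
  rw [Complex.cos]
  simp [Finset.sum_range_succ, Nat.factorial, mul_pow]
  rw [mul_comm I t]
  field_simp
  ring

lemma norm_sinh_sq (w : ℂ) : ‖Complex.sinh w‖ ^ 2 = Real.sinh w.re ^ 2 + Real.sin w.im ^ 2 := by
  rw [← Complex.normSq_eq_norm_sq]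
  conv_lhs => rw [← Complex.re_add_im w]
  rw [Complex.sinh_add, Complex.cosh_mul_I, Complex.sinh_mul_I, ← Complex.ofReal_sinh,
    ← Complex.ofReal_cosh, ← Complex.ofReal_cos, ← Complex.ofReal_sin, Complex.normSq_apply]
  simp only [add_re, add_im, mul_re, mul_im, ofReal_re, ofReal_im, I_re, I_im, mul_zero, mul_one,
    zero_mul, sub_zero, add_zero, zero_add]
  have h1 := Real.cosh_sq w.re
  have h2 := Real.sin_sq_add_cos_sq w.im
  linear_combination Real.sin w.im ^ 2 * h1 + Real.sinh w.re ^ 2 * h2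

lemma abs_le_norm_sinh (w : ℂ) : |w.re| ≤ ‖Complex.sinh w‖ := by
  have h1 : |w.re| ≤ |Real.sinh w.re| := by
    rw [Real.abs_sinh]; exact Real.self_le_sinh_iff.2 (abs_nonneg _)
  refine h1.trans (abs_le_of_sq_le_sq ?_ (norm_nonneg _) |> fun h => h)
  rw [norm_sinh_sq]; nlinarith [sq_nonneg (Real.sin w.im)]

lemma le_norm_sinh (w : ℂ) : |Real.sin w.im| * Real.cosh w.re ≤ ‖Complex.sinh w‖ := by
  refine le_of_sq_le_sq ?_ (norm_nonneg _) |> fun h => h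
  rw [norm_sinh_sq, mul_pow, sq_abs, Real.cosh_sq]
  nlinarith [Real.sin_sq_le_one w.im, sq_nonneg (Real.sinh w.re)]

lemma shc_ne (w : ℂ) (hw : |w.im| < π) : shc w ≠ 0 := by
  by_cases h0 : w = 0
  · rw [h0, shc_zero]; exact one_ne_zero
  intro h
  have h1 := shc_mul w
  rw [h, mul_zero] at h1
  have h2 := norm_sinh_sq w
  rw [← h1] at h2
  simp at h2
  have h3 : Real.sinh w.re = 0 := by nlinarith [sq_nonneg (Real.sinh w.re), sq_nonneg (Real.sin w.im)]
  have h4 : Real.sin w.im = 0 := by nlinarith [sq_nonneg (Real.sinh w.re), sq_nonneg (Real.sin w.im)]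
  have h5 := Real.sinh_eq_zero.1 h3
  have h6 := (Real.sin_eq_zero_iff_of_lt_of_lt (abs_lt.1 hw).1 (abs_lt.1 hw).2).1 h4
  exact h0 (Complex.ext h5 h6)

lemma cosh_bound (x : ℝ) : 1 + x ^ 2 ≤ Real.cosh (π * x) := by
  have h1 : Real.cosh (π * x) = Real.cosh (2 * (π * x / 2)) := by ring_nf
  have h3 : |π * x / 2| ≤ |Real.sinh (π * x / 2)| := by
    rw [Real.abs_sinh]; exact Real.self_le_sinh_iff.2 (abs_nonneg _)
  have h4 := sq_le_sq.2 h3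
  rw [h1, Real.cosh_two_mul, Real.cosh_sq]
  have h5 : 9 * x ^ 2 ≤ π ^ 2 * x ^ 2 := by
    have := Real.pi_gt_three
    gcongr
    nlinarith
  nlinarith [sq_nonneg x]

open MeasureTheory in
lemma aux_int (h δ z : ℝ) (hh : 0 < h) (hδ0 : 0 < δ) (h1 : δ < 1) (h2 : δ * h < 1) :
    Integrable (fun t : ℝ => Complex.exp (-Complex.I * (t + Complex.I * δ) * z) /
      (Complex.sinh (Real.pi * (t + Complex.I * δ)) *
        Complex.sinh (Real.pi * h * (t + Complex.I * δ)) * (t + Complex.I * δ))) := by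
  have hπ := Real.pi_pos
  have s1 : 0 < Real.sin (π * δ) := Real.sin_pos_of_pos_of_lt_pi (by positivity) (by nlinarith)
  have s2 : 0 < Real.sin (π * h * δ) := Real.sin_pos_of_pos_of_lt_pi (by positivity) (by nlinarith)
  have b1 : ∀ t : ℝ, Real.sin (π * δ) * (1 + t ^ 2) ≤ ‖Complex.sinh (Real.pi * (t + Complex.I * δ))‖ := by
    intro t
    refine le_trans ?_ (le_norm_sinh _)
    have e1 : ((π:ℂ) * (t + Complex.I * δ)).im = π * δ := by simp
    have e2 : ((π:ℂ) * (t + Complex.I * δ)).re = π * t := by simp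
    rw [e1, e2, abs_of_pos s1]
    gcongr
    exact cosh_bound t
  have b2 : ∀ t : ℝ, Real.sin (π * h * δ) ≤ ‖Complex.sinh (Real.pi * h * (t + Complex.I * δ))‖ := by
    intro t
    refine le_trans ?_ (le_norm_sinh _)
    have e1 : ((π:ℂ) * h * (t + Complex.I * δ)).im = π * h * δ := by simp
    rw [e1, abs_of_pos s2]
    exact le_mul_of_one_le_right s2.le (Real.one_le_cosh _)
  have b3 : ∀ t : ℝ, δ ≤ ‖(t + Complex.I * δ : ℂ)‖ := by
    intro t
    have := Complex.abs_im_le_norm (t + Complex.I * δ : ℂ)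
    simp [abs_of_pos hδ0] at this
    simpa using this
  have b4 : ∀ t : ℝ, ‖Complex.exp (-Complex.I * (t + Complex.I * δ) * z)‖ = Real.exp (δ * z) := by
    intro t
    rw [Complex.norm_exp]; simp
  refine ((integrable_inv_one_add_sq.const_mul (Real.exp (δ * z) / (Real.sin (π * δ) * Real.sin (π * h * δ) * δ)))).mono' ?_ ?_
  · refine (Continuous.div (by fun_prop) (by fun_prop) (fun t => ?_)).aestronglyMeasurable
    refine norm_pos_iff.1 ?_
    rw [norm_mul, norm_mul]
    have q1 : 0 < Real.sin (π * δ) * (1 + t ^ 2) := by positivity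
    have := q1.trans_le (b1 t)
    have := s2.trans_le (b2 t)
    have := hδ0.trans_le (b3 t)
    positivity
  · refine Filter.Eventually.of_forall (fun t => ?_)
    rw [norm_div, norm_mul, norm_mul, b4]
    have : Real.exp (δ * z) / (Real.sin (π * δ) * Real.sin (π * h * δ) * δ) * (1 + t ^ 2)⁻¹ =
      Real.exp (δ * z) / ((Real.sin (π * δ) * (1 + t ^ 2)) * Real.sin (π * h * δ) * δ) := by
      field_simp
    rw [this]
    have q1 : 0 < Real.sin (π * δ) * (1 + t ^ 2) := by positivity
    gcongr
    · exact b1 t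
    · exact b2 t
    · exact b3 t

/-- Numerator of the symmetrized integrand. -/
noncomputable def numer (h z : ℝ) (t : ℂ) : ℂ :=
  2 / (π ^ 2 * h) * (Complex.cos (z * t) * ((shc (π * t))⁻¹ * (shc (π * h * t))⁻¹))

lemma numer_zero (h z : ℝ) : numer h z 0 = 2 / (π ^ 2 * h) := by
  simp [numer, shc_zero]

lemma numer_div (h z : ℝ) (hh : 0 < h) (t : ℂ) (ht : t ≠ 0) :
    numer h z t / t ^ 3 = (2 * Complex.cos (z * t)) /
      (Complex.sinh (π * t) * Complex.sinh (π * h * t) * t) := by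
  have hπ : (π:ℂ) ≠ 0 := by exact_mod_cast Real.pi_ne_zero
  have hh' : (h:ℂ) ≠ 0 := by exact_mod_cast hh.ne'
  rw [← shc_mul, ← shc_mul, numer]
  simp only [div_eq_mul_inv, mul_inv]
  field_simp

theorem qdilog_exponent_sum (h δ z : ℝ) (hh : 0 < h) (hδ0 : 0 < δ) (hδ : δ < min 1 (1 / h)) :
    ∫ x : ℝ, numer h z (x + I * δ) / (x + I * δ) ^ 3 = -(π * I) *
      (2 / (π ^ 2 * h) * (z ^ 2 * (-1 / 2) + (π ^ 2 * (-(1 / 6)) + (π * h) ^ 2 * (-(1 / 6))))) := by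
  have hπ := Real.pi_pos
  have h1 : δ < 1 := hδ.trans_le (min_le_left _ _)
  have h2 : δ * h < 1 := (lt_div_iff₀ hh).1 (hδ.trans_le (min_le_right _ _))
  have hne : ∀ x : ℝ, (x + I * δ : ℂ) ≠ 0 := fun x h => by
    have := congrArg Complex.im h; simp at this; linarith
  refine aux_shift (numer h z) (min 1 (1 / h)) δ hδ0 hδ ?_ ?_ (2 * Real.exp (δ * |z|) / h) ?_ ?_ _ ?_
  · intro t
    simp only [numer, mul_neg, shc_neg, Complex.cos_neg]
  · intro t ht
    have ht : |t.im| < min 1 (1 / h) := ht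
    have t1 : |t.im| < 1 := ht.trans_le (min_le_left _ _)
    have t2 : |t.im| * h < 1 := (lt_div_iff₀ hh).1 (ht.trans_le (min_le_right _ _))
    have n1 : shc (π * t) ≠ 0 := shc_ne _ (by
      simp [abs_mul, abs_of_pos hπ]; nlinarith)
    have n2 : shc (π * h * t) ≠ 0 := shc_ne _ (by
      simp [abs_mul, abs_of_pos hπ, abs_of_pos hh]; nlinarith)
    have d := shc_diff
    refine DifferentiableAt.differentiableWithinAt ?_
    unfold numer
    refine DifferentiableAt.const_mul (DifferentiableAt.mul (by fun_prop) (DifferentiableAt.mul ?_ ?_)) _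
    · exact DifferentiableAt.inv ((d _).comp t (by fun_prop)) n1
    · exact DifferentiableAt.inv ((d _).comp t (by fun_prop)) n2
  · intro t tr ti
    have ht : |t.re| ≤ ‖t‖ := Complex.abs_re_le_norm t
    have t0 : t ≠ 0 := norm_pos_iff.1 (by linarith)
    rw [numer_div h z hh t t0, norm_div, norm_mul (_ * _) t, norm_mul (Complex.sinh _)]
    have c1 : ‖2 * Complex.cos (z * t)‖ ≤ 2 * Real.exp (δ * |z|) := by
      rw [Complex.two_cos]
      refine (norm_add_le _ _).trans ?_
      rw [Complex.norm_exp, Complex.norm_exp, two_mul]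
      have hz : |z * t.im| ≤ δ * |z| := by
        rw [abs_mul, mul_comm]; gcongr
      have := abs_le.1 hz
      gcongr
      · simp; linarith
      · simp; linarith
    have c2 : 1 ≤ ‖Complex.sinh (π * t)‖ := by
      refine le_trans ?_ (abs_le_norm_sinh _)
      simp [abs_mul, abs_of_pos hπ]
      nlinarith [Real.pi_gt_three]
    have c3 : h ≤ ‖Complex.sinh (π * h * t)‖ := by
      refine le_trans ?_ (abs_le_norm_sinh _)
      simp [abs_mul, abs_of_pos hπ, abs_of_pos hh]
      have : 1 ≤ π * |t.re| := by nlinarith [Real.pi_gt_three]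
      nlinarith
    rw [div_div]
    have : 0 < h * |t.re| := by positivity
    gcongr
    calc h = 1 * h := by ring
      _ ≤ _ := by gcongr
  · have i1 := aux_int h δ z hh hδ0 h1 h2
    have i2 := aux_int h δ (-z) hh hδ0 h1 h2
    refine (i1.add i2).congr (Filter.Eventually.of_forall fun x => ?_)
    simp only [Pi.add_apply]
    rw [numer_div h z hh _ (hne x), Complex.two_cos, ← add_div, add_comm]
    push_cast
    ring_nf
  · have l := aux_lim_mul _ _ _ _ (aux_lim_scale _ _ (z:ℂ) Complex.cos_zero cos_lim)
      (aux_lim_mul _ _ _ _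
        (aux_lim_inv _ _ (aux_lim_scale _ _ (π:ℂ) shc_zero shc_lim))
        (aux_lim_inv _ _ (aux_lim_scale _ _ (π * h:ℂ) shc_zero shc_lim)))
    have l := l.const_mul (2 / ((π:ℂ) ^ 2 * h))
    simp only [← mul_neg] at l
    refine l.congr (fun t => ?_)
    rw [numer_zero, numer]
    ring

theorem qdilog_inversion (h δ z : ℝ) (hh : 0 < h) (hδ0 : 0 < δ) (hδ : δ < min 1 (1 / h)) :
    qdilog h δ z * qdilog h δ (-z) =
      Complex.exp ((z : ℂ) ^ 2 / (4 * Real.pi * Complex.I * h)) *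
        Complex.exp (-(Real.pi * Complex.I / 12) * (h + (h : ℂ)⁻¹)) := by
  have h1 : δ < 1 := hδ.trans_le (min_le_left _ _)
  have h2 : δ * h < 1 := (lt_div_iff₀ hh).1 (hδ.trans_le (min_le_right _ _))
  have hne : ∀ x : ℝ, (x + I * δ : ℂ) ≠ 0 := fun x h => by
    have := congrArg Complex.im h; simp at this; linarith
  have i1 := aux_int h δ z hh hδ0 h1 h2
  have i2 := aux_int h δ (-z) hh hδ0 h1 h2
  have key := qdilog_exponent_sum h δ z hh hδ0 hδ
  have hsum : ∫ x : ℝ, numer h z (x + I * δ) / (x + I * δ) ^ 3 = _ + _ :=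
    Eq.trans (MeasureTheory.integral_congr_ae (Filter.Eventually.of_forall fun x => by
      simp only []
      rw [numer_div h z hh _ (hne x), Complex.two_cos, add_comm, add_div]
      push_cast
      ring_nf)) (MeasureTheory.integral_add i1 i2)
  rw [hsum] at key
  unfold qdilog
  rw [← Complex.exp_add, ← Complex.exp_add]
  congr 1
  unfold qdilogExponent
  rw [← mul_add, key]
  have hπ : (π:ℂ) ≠ 0 := by exact_mod_cast Real.pi_ne_zero
  have hh' : (h:ℂ) ≠ 0 := by exact_mod_cast hh.ne'
  field_simp
  ring_nf
  simp
  ring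

end Stmt7
end
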